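/- arXiv:2109.13106 — 3 statements merged into one kernel-verified Lean document; each statement's English description precedes it below -/
import Mathlib

section
/- Let d be a positive integer and let μ₁, …, μ_d be finite measures on ℝ^d such that every affine hyperplane has measure zero for each μᵢ. Then there exist a unit vector v ∈ ℝ^d and a real number c such that for every i = 1, …, d one has μᵢ({x : ⟨x, v⟩ ≥ c}) = μᵢ({x : ⟨x, v⟩ ≤ c}); that is, the hyperplane {x : ⟨x, v⟩ = c} simultaneously bisects all d measures. -/
open MeasureTheory
open scoped RealInnerProductSpace

/-- Mod 2 chains of ordered simplices (lists of vertices) in `V`. -/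
abbrev SimplexChain (V : Type*) : Type _ := List V →₀ ZMod 2

namespace SimplexChain

section Algebra

variable {V : Type*}

/-- The linear extension of a function on simplices. -/
noncomputable abbrev lift {M : Type*} [AddCommGroup M] [Module (ZMod 2) M] (u : List V → M) :
    SimplexChain V →ₗ[ZMod 2] M :=
  Finsupp.linearCombination (ZMod 2) u

/-- The simplex `σ` as a chain. -/
noncomputable abbrev of (σ : List V) : SimplexChain V := Finsupp.single σ 1

theorem lift_of {M : Type*} [AddCommGroup M] [Module (ZMod 2) M] (u : List V → M)
    (σ : List V) : lift u (of σ) = u σ := by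
  simp [lift, of]

theorem hom_ext {M : Type*} [AddCommGroup M] [Module (ZMod 2) M]
    {f g : SimplexChain V →ₗ[ZMod 2] M} (h : ∀ σ, f (of σ) = g (of σ)) : f = g :=
  Finsupp.lhom_ext' fun σ => LinearMap.ext_ring (h σ)

/-- The cone with apex `p`. -/
noncomputable def cone (p : V) : SimplexChain V →ₗ[ZMod 2] SimplexChain V :=
  lift fun σ => of (p :: σ)

@[simp] theorem cone_of (p : V) (σ : List V) : cone p (of σ) = of (p :: σ) := lift_of _ _

/-- The boundary of a simplex in the augmented chain complex. -/
noncomputable def boundarySimplex : List V → SimplexChain V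
  | [] => 0
  | p :: σ => of σ + cone p (boundarySimplex σ)

/-- The boundary operator of the augmented chain complex. -/
noncomputable def boundary : SimplexChain V →ₗ[ZMod 2] SimplexChain V := lift boundarySimplex

@[simp] theorem boundary_of_nil : boundary (of ([] : List V)) = 0 := lift_of _ _

theorem boundary_of_cons (p : V) (σ : List V) :
    boundary (of (p :: σ)) = of σ + cone p (boundary (of σ)) := by
  simp only [boundary, lift_of, boundarySimplex]

theorem boundary_cone (p : V) (c : SimplexChain V) :
    boundary (cone p c) = c + cone p (boundary c) := by
  have : boundary ∘ₗ cone p = LinearMap.id + cone p ∘ₗ boundary :=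
    hom_ext fun σ => by simp [boundary_of_cons]
  exact LinearMap.congr_fun this c

@[simp] theorem boundary_boundary (c : SimplexChain V) : boundary (boundary c) = 0 := by
  have : (boundary ∘ₗ boundary : SimplexChain V →ₗ[ZMod 2] _) = 0 := by
    refine hom_ext fun σ => ?_
    induction σ with
    | nil => simp
    | cons p σ ih =>
      simp only [LinearMap.comp_apply, LinearMap.zero_apply] at ih ⊢
      rw [boundary_of_cons, map_add, boundary_cone, ih, map_zero, add_zero,
        ZModModule.add_self]
  exact LinearMap.congr_fun this c

/-- The chain map induced by negation of the vertices. -/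
noncomputable def antipode [Neg V] : SimplexChain V →ₗ[ZMod 2] SimplexChain V :=
  lift fun σ => of (σ.map Neg.neg)

@[simp] theorem antipode_of [Neg V] (σ : List V) :
    antipode (of σ) = of (σ.map Neg.neg) := lift_of _ _

@[simp] theorem antipode_antipode [InvolutiveNeg V] (c : SimplexChain V) :
    antipode (antipode c) = c := by
  have : (antipode ∘ₗ antipode : SimplexChain V →ₗ[ZMod 2] _) = LinearMap.id :=
    hom_ext fun σ => by simp
  exact LinearMap.congr_fun this c

theorem antipode_cone [Neg V] (p : V) (c : SimplexChain V) :
    antipode (cone p c) = cone (-p) (antipode c) := by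
  have : antipode ∘ₗ cone p = cone (-p) ∘ₗ antipode := hom_ext fun σ => by simp
  exact LinearMap.congr_fun this c

theorem boundary_antipode [Neg V] (c : SimplexChain V) :
    boundary (antipode c) = antipode (boundary c) := by
  have : boundary ∘ₗ antipode = antipode ∘ₗ (boundary : SimplexChain V →ₗ[ZMod 2] _) := by
    refine hom_ext fun σ => ?_
    induction σ with
    | nil => simp
    | cons p σ ih =>
      simp only [LinearMap.comp_apply, antipode_of] at ih
      simp only [LinearMap.comp_apply, antipode_of, List.map_cons, boundary_of_cons, map_add,
        ih, antipode_cone]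
  exact LinearMap.congr_fun this c

/-- The chains all of whose simplices satisfy `P`. -/
abbrev supportedOn (P : List V → Prop) : Submodule (ZMod 2) (SimplexChain V) :=
  Finsupp.supported (ZMod 2) (ZMod 2) {σ | P σ}

theorem of_mem {P : List V → Prop} {σ : List V} (h : P σ) : of σ ∈ supportedOn P :=
  Finsupp.single_mem_supported _ _ h

theorem map_mem_of {M : Type*} [AddCommGroup M] [Module (ZMod 2) M] {P : List V → Prop}
    {S : Submodule (ZMod 2) M} {f : SimplexChain V →ₗ[ZMod 2] M}
    (h : ∀ σ, P σ → f (of σ) ∈ S) {c : SimplexChain V} (hc : c ∈ supportedOn P) : f c ∈ S := by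
  have hle : supportedOn P ≤ S.comap f := by
    rw [supportedOn, Finsupp.supported_eq_span_single, Submodule.span_le]
    rintro _ ⟨σ, hσ, rfl⟩
    exact h σ hσ
  exact hle hc

theorem eqOn_of {M : Type*} [AddCommGroup M] [Module (ZMod 2) M] {P : List V → Prop}
    {f g : SimplexChain V →ₗ[ZMod 2] M}
    (h : ∀ σ, P σ → f (of σ) = g (of σ)) {c : SimplexChain V} (hc : c ∈ supportedOn P) :
    f c = g c :=
  LinearMap.mem_eqLocus.1 (map_mem_of (f := LinearMap.id) (S := LinearMap.eqLocus f g) h hc)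

theorem boundary_of_mem (σ : List V) :
    boundary (of σ) ∈ supportedOn fun τ => τ.length + 1 = σ.length ∧ τ ⊆ σ := by
  induction σ with
  | nil => simp
  | cons p σ ih =>
    rw [boundary_of_cons]
    refine Submodule.add_mem _ (of_mem ⟨rfl, List.subset_cons_self _ _⟩) (map_mem_of ?_ ih)
    rintro τ ⟨h₁, h₂⟩
    rw [cone_of]
    exact of_mem ⟨by simp [h₁], List.cons_subset_cons _ h₂⟩

theorem boundary_mem_forall {Q : V → Prop} {c : SimplexChain V}
    (hc : c ∈ supportedOn fun σ => ∀ v ∈ σ, Q v) :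
    boundary c ∈ supportedOn fun σ => ∀ v ∈ σ, Q v :=
  map_mem_of (fun σ hσ =>
    Finsupp.supported_mono (fun _ hτ v hv => hσ v (hτ.2 hv)) (boundary_of_mem σ)) hc

/-- Multiplication of a cochain by the value of `s` at the first vertex. -/
noncomputable def headMul (s : V → ZMod 2) (D : SimplexChain V →ₗ[ZMod 2] ZMod 2) :
    SimplexChain V →ₗ[ZMod 2] ZMod 2 :=
  lift fun σ => (σ.head?.map s).getD 0 * D (of σ)

/-- The cup product of the coboundaries of the `0`-cochains `s (k - 1), …, s 0`. -/
noncomputable def cupCoboundary (s : ℕ → V → ZMod 2) : ℕ → SimplexChain V →ₗ[ZMod 2] ZMod 2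
  | 0 => Finsupp.lapply [] ∘ₗ boundary
  | k + 1 => headMul (s k) (cupCoboundary s k) ∘ₗ boundary

theorem cupCoboundary_boundary (s : ℕ → V → ZMod 2) (k : ℕ) (c : SimplexChain V) :
    cupCoboundary s k (boundary c) = 0 := by
  cases k <;> simp [cupCoboundary]

theorem cupCoboundary_of_nil (s : ℕ → V → ZMod 2) (k : ℕ) :
    cupCoboundary s k (of []) = 0 := by
  cases k <;> simp only [cupCoboundary, LinearMap.comp_apply, boundary_of_nil, map_zero]

theorem headMul_antipode [Neg V] {Q : V → Prop} {s : V → ZMod 2}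
    {D : SimplexChain V →ₗ[ZMod 2] ZMod 2} (hs : ∀ v, Q v → s (-v) = s v + 1)
    (hnil : D (of []) = 0)
    (hD : ∀ c ∈ supportedOn fun σ => ∀ v ∈ σ, Q v, D (antipode c) = D c)
    {c : SimplexChain V} (hc : c ∈ supportedOn fun σ => ∀ v ∈ σ, Q v) :
    headMul s D (antipode c) = headMul s D c + D c := by
  refine eqOn_of (f := headMul s D ∘ₗ antipode) (g := headMul s D + D) (fun σ hσ => ?_) hc
  have h := hD _ (of_mem hσ)
  simp only [LinearMap.comp_apply, LinearMap.add_apply, antipode_of, headMul, lift_of] at h ⊢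
  cases σ with
  | nil => simp [hnil]
  | cons p σ =>
    rw [h]
    simp [hs p (hσ p (by simp)), add_mul]

theorem cupCoboundary_antipode [Neg V] {Q : V → Prop} {s : ℕ → V → ZMod 2}
    (hs : ∀ k v, Q v → s k (-v) = s k v + 1) (k : ℕ) :
    ∀ c ∈ supportedOn fun σ => ∀ v ∈ σ, Q v,
      cupCoboundary s k (antipode c) = cupCoboundary s k c := by
  induction k with
  | zero =>
    intro c _
    have : (Finsupp.lapply [] ∘ₗ antipode : SimplexChain V →ₗ[ZMod 2] ZMod 2) =
        Finsupp.lapply [] := by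
      refine hom_ext fun σ => ?_
      cases σ <;> simp [of]
    simpa [cupCoboundary, boundary_antipode] using LinearMap.congr_fun this (boundary c)
  | succ k ih =>
    intro c hc
    simp only [cupCoboundary, LinearMap.comp_apply, boundary_antipode]
    rw [headMul_antipode (hs k) (cupCoboundary_of_nil s k) ih (boundary_mem_forall hc),
      cupCoboundary_boundary, add_zero]

theorem cupCoboundary_eq_zero {s : ℕ → V → ZMod 2} {i : ℕ} {Q : V → Prop} {a : ZMod 2}
    (hs : ∀ v, Q v → s i v = a) {k : ℕ} (hk : i < k) :
    ∀ c ∈ supportedOn fun σ => ∀ v ∈ σ, Q v, cupCoboundary s k c = 0 := by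
  induction k, hk using Nat.le_induction with
  | base =>
    intro c hc
    have : headMul (s i) (cupCoboundary s i) (boundary c) =
        (a • cupCoboundary s i) (boundary c) := by
      refine eqOn_of (fun σ hσ => ?_) (boundary_mem_forall hc)
      rw [headMul, lift_of]
      cases σ with
      | nil => simp [cupCoboundary_of_nil]
      | cons p σ => simp [hs p (hσ p (by simp))]
    simp only [cupCoboundary, LinearMap.comp_apply]
    rw [this, LinearMap.smul_apply, cupCoboundary_boundary, smul_zero]
  | succ k _ ih =>
    intro c hc
    have : headMul (s k) (cupCoboundary s k) (boundary c) =
        (0 : SimplexChain V →ₗ[ZMod 2] ZMod 2) (boundary c) := by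
      refine eqOn_of (fun σ hσ => ?_) (boundary_mem_forall hc)
      rw [headMul, lift_of, ih _ (of_mem hσ), mul_zero, LinearMap.zero_apply]
    simpa [cupCoboundary] using this

/-- The join of the `0`-spheres `{e 0, -e 0}, …, {e (k - 1), -e (k - 1)}`. -/
noncomputable def sphere [Neg V] (e : ℕ → V) : ℕ → SimplexChain V
  | 0 => of []
  | k + 1 => cone (e k) (sphere e k) + antipode (cone (e k) (sphere e k))

theorem boundary_sphere [InvolutiveNeg V] (e : ℕ → V) (k : ℕ) : boundary (sphere e k) = 0 := by
  have hA : ∀ k, antipode (sphere e k) = sphere e k := by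
    intro k
    cases k with
    | zero => simp [sphere]
    | succ k => simp only [sphere, map_add, antipode_antipode, add_comm]
  induction k with
  | zero => exact boundary_of_nil
  | succ k ih =>
    simp only [sphere, map_add, boundary_antipode, boundary_cone, ih, map_zero, add_zero, hA,
      ZModModule.add_self]

theorem boundary_cone_sphere [InvolutiveNeg V] (e : ℕ → V) (k : ℕ) (p : V) :
    boundary (cone p (sphere e k)) = sphere e k := by
  rw [boundary_cone, boundary_sphere, map_zero, add_zero]

end Algebra

section Subdivision

variable {V : Type*} [NormedAddCommGroup V] [NormedSpace ℝ V]

/-- The barycenter of a simplex. -/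
noncomputable def barycenter (σ : List V) : V := (σ.length : ℝ)⁻¹ • σ.sum

theorem barycenter_map_neg (σ : List V) : barycenter (σ.map Neg.neg) = -barycenter σ := by
  have : (σ.map Neg.neg).sum = -σ.sum := by
    induction σ with
    | nil => simp
    | cons p σ ih => simp [ih, add_comm]
  simp [barycenter, this]

/-- Barycentric subdivision of chains of simplices with `k` vertices. -/
noncomputable def subdivide : ℕ → SimplexChain V →ₗ[ZMod 2] SimplexChain V
  | 0 => LinearMap.id
  | k + 1 => lift fun σ => cone (barycenter σ) (subdivide k (boundary (of σ)))

theorem boundary_subdivide (k : ℕ) (c : SimplexChain V) :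
    boundary (subdivide (k + 1) c) = subdivide k (boundary c) := by
  induction k generalizing c with
  | zero =>
    have : boundary ∘ₗ subdivide 1 =
        subdivide 0 ∘ₗ (boundary : SimplexChain V →ₗ[ZMod 2] _) := by
      refine hom_ext fun σ => ?_
      simp [subdivide, boundary_cone]
    exact LinearMap.congr_fun this c
  | succ k ih =>
    have : boundary ∘ₗ subdivide (k + 2) =
        subdivide (k + 1) ∘ₗ (boundary : SimplexChain V →ₗ[ZMod 2] _) := by
      refine hom_ext fun σ => ?_
      rw [LinearMap.comp_apply, LinearMap.comp_apply, subdivide, lift_of, boundary_cone, ih]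
      simp
    exact LinearMap.congr_fun this c

theorem subdivide_antipode (k : ℕ) (c : SimplexChain V) :
    subdivide k (antipode c) = antipode (subdivide k c) := by
  induction k generalizing c with
  | zero => rfl
  | succ k ih =>
    have : subdivide (k + 1) ∘ₗ antipode =
        antipode ∘ₗ (subdivide (k + 1) : SimplexChain V →ₗ[ZMod 2] _) := by
      refine hom_ext fun σ => ?_
      simp only [LinearMap.comp_apply, antipode_of, subdivide, lift_of, antipode_cone,
        barycenter_map_neg, ← ih, ← boundary_antipode]
    exact LinearMap.congr_fun this c

theorem boundary_subdivide_iterate (k r : ℕ) (c : SimplexChain V) :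
    boundary ((subdivide (k + 1))^[r] c) = (subdivide k)^[r] (boundary c) :=
  Function.Semiconj.iterate_right (boundary_subdivide k) r c

theorem subdivide_iterate_antipode (k r : ℕ) (c : SimplexChain V) :
    (subdivide k)^[r] (antipode c) = antipode ((subdivide k)^[r] c) :=
  (Function.Semiconj.iterate_right (fun c => (subdivide_antipode k c).symm) r c).symm

theorem barycenter_mem {C : Set V} (hC : Convex ℝ C) {σ : List V} (hσ : σ ≠ [])
    (h : ∀ v ∈ σ, v ∈ C) : barycenter σ ∈ C := by
  have hL : (σ.length : ℝ) ≠ 0 := by simpa using hσ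
  rw [barycenter, ← Fin.sum_univ_getElem, Finset.smul_sum]
  exact hC.sum_mem (fun _ _ => by positivity) (by simp [hL]) fun i _ => h _ (List.getElem_mem _)

theorem dist_barycenter_le {σ : List V} {R : ℝ} (h : ∀ v ∈ σ, ∀ w ∈ σ, dist v w ≤ R)
    {v : V} (hv : v ∈ σ) :
    dist v (barycenter σ) ≤ ((σ.length : ℝ) - 1) / σ.length * R := by
  obtain ⟨j, hj, rfl⟩ := List.getElem_of_mem hv
  have hL : (0 : ℝ) < σ.length := by exact_mod_cast (by omega : 0 < σ.length)
  have key : σ[j] - barycenter σ =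
      (σ.length : ℝ)⁻¹ • ∑ i : Fin σ.length, (σ[j] - σ[i]) := by
    rw [Finset.sum_sub_distrib, barycenter, ← Fin.sum_univ_getElem, smul_sub]
    simp [← Nat.cast_smul_eq_nsmul ℝ, smul_smul, hL.ne']
  have hsum : ‖∑ i : Fin σ.length, (σ[j] - σ[i])‖ ≤ ((σ.length : ℝ) - 1) * R := by
    rw [← Finset.add_sum_erase _ _ (Finset.mem_univ (⟨j, hj⟩ : Fin σ.length))]
    simp only [Fin.getElem_fin, sub_self, zero_add]
    refine (norm_sum_le_of_le (n := fun _ => R) _ fun i _ => ?_).trans ?_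
    · rw [← dist_eq_norm]
      exact h _ (List.getElem_mem _) _ (List.getElem_mem _)
    · simp only [Finset.sum_const, Finset.card_erase_of_mem (Finset.mem_univ _),
        Finset.card_univ, Fintype.card_fin, nsmul_eq_mul]
      rw [Nat.cast_sub (by omega)]
      simp
  rw [dist_eq_norm, key, norm_smul, norm_inv, Real.norm_natCast, div_mul_eq_mul_div,
    div_eq_inv_mul]
  gcongr

/-- The simplices with `k` vertices in `C` at mutual distance at most `R`. -/
def IsSmall (k : ℕ) (C : Set V) (R : ℝ) (σ : List V) : Prop :=
  σ.length = k ∧ (∀ v ∈ σ, v ∈ C) ∧ ∀ v ∈ σ, ∀ w ∈ σ, dist v w ≤ R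

theorem subdivide_of_mem {n k : ℕ} (hk : k ≤ n + 1) {C : Set V} (hC : Convex ℝ C) {R : ℝ}
    (hR : 0 ≤ R) {σ : List V} (hσ : IsSmall k C R σ) :
    subdivide k (of σ) ∈ supportedOn (IsSmall k C ((n : ℝ) / (n + 1) * R)) := by
  induction k generalizing C σ with
  | zero =>
    obtain rfl := List.length_eq_zero_iff.1 hσ.1
    exact of_mem ⟨rfl, by simp, by simp⟩
  | succ k ih =>
    obtain ⟨hlen, hmem, hdist⟩ := hσ
    have hne : σ ≠ [] := by rintro rfl; simp at hlen
    set b := barycenter σ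
    set q : ℝ := (n : ℝ) / (n + 1) * R
    have hb : ∀ v ∈ σ, dist v b ≤ q := fun v hv => by
      refine (dist_barycenter_le hdist hv).trans ?_
      have hkn : (k : ℝ) ≤ n := by exact_mod_cast (by omega : k ≤ n)
      rw [hlen]
      change _ ≤ (n : ℝ) / (n + 1) * R
      push_cast
      gcongr ?_ * R
      rw [div_le_div_iff₀ (by positivity) (by positivity)]
      nlinarith
    have hq : 0 ≤ q := by positivity
    rw [subdivide, lift_of]
    have hfacets : subdivide k (boundary (of σ)) ∈
        supportedOn (IsSmall k (C ∩ Metric.closedBall b q) q) := by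
      refine map_mem_of (fun τ hτ => ih (by omega) (hC.inter (convex_closedBall b q)) ?_)
        (boundary_of_mem σ)
      obtain ⟨h₁, h₂⟩ := hτ
      exact ⟨by omega, fun v hv => ⟨hmem v (h₂ hv), hb v (h₂ hv)⟩,
        fun v hv w hw => hdist v (h₂ hv) w (h₂ hw)⟩
    refine map_mem_of (fun τ hτ => ?_) hfacets
    rw [cone_of]
    obtain ⟨h₁, h₂, h₃⟩ := hτ
    refine of_mem ⟨by simp [h₁], ?_, ?_⟩
    · simp only [List.mem_cons, forall_eq_or_imp]
      exact ⟨barycenter_mem hC hne hmem, fun v hv => (h₂ v hv).1⟩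
    · simp only [List.mem_cons, forall_eq_or_imp, dist_self]
      exact ⟨⟨hq, fun w hw => by rw [dist_comm]; exact (h₂ w hw).2⟩,
        fun v hv => ⟨(h₂ v hv).2, h₃ v hv⟩⟩

theorem subdivide_iterate_mem {ι : Type*} {n k : ℕ} (hk : k ≤ n + 1) {C : ι → Set V}
    (hC : ∀ a, Convex ℝ (C a)) {R : ℝ} (hR : 0 ≤ R) {c : SimplexChain V}
    (hc : c ∈ supportedOn fun σ => ∃ a, IsSmall k (C a) R σ) (r : ℕ) :
    (subdivide k)^[r] c ∈
      supportedOn fun σ => ∃ a, IsSmall k (C a) (((n : ℝ) / (n + 1)) ^ r * R) σ := by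
  induction r with
  | zero => simpa using hc
  | succ r ih =>
    rw [Function.iterate_succ_apply']
    refine map_mem_of (fun σ ⟨a, hσ⟩ => ?_) ih
    refine Finsupp.supported_mono (fun τ hτ => ?_)
      (subdivide_of_mem hk (hC a) (by positivity) hσ)
    exact ⟨a, by rw [pow_succ', mul_assoc]; exact hτ⟩

theorem cupCoboundary_subdivide_cone_sphere {Q : V → Prop} {s : ℕ → V → ZMod 2}
    (hs : ∀ k v, Q v → s k (-v) = s k v + 1) (e : ℕ → V) {n r : ℕ}
    (hQ : ∀ k ≤ n, (subdivide (k + 1))^[r] (cone (e k) (sphere e k)) ∈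
      supportedOn fun σ => ∀ v ∈ σ, Q v) :
    ∀ k ≤ n, cupCoboundary s k ((subdivide (k + 1))^[r] (cone (e k) (sphere e k))) = 1 := by
  intro k hk
  induction k with
  | zero =>
    have h : (subdivide 0)^[r] (of ([] : List V)) = of [] := Function.iterate_fixed rfl r
    rw [cupCoboundary, LinearMap.comp_apply, boundary_subdivide_iterate, boundary_cone_sphere,
      sphere, h]
    simp [of]
  | succ k ih =>
    rw [cupCoboundary, LinearMap.comp_apply, boundary_subdivide_iterate, boundary_cone_sphere,
      sphere, iterate_map_add, subdivide_iterate_antipode, map_add,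
      headMul_antipode (hs k) (cupCoboundary_of_nil s k) (cupCoboundary_antipode hs k)
        (hQ k (by omega)), ← add_assoc, ZModModule.add_self, zero_add, ih (by omega)]

end Subdivision

end SimplexChain

namespace SimplexChain

/-- The points of the unit ball of the sup norm at which the linear form with coefficients `ε`
takes the value `1`. -/
def slab {n : ℕ} (ε : Fin (n + 1) → ℝ) : Set (Fin (n + 1) → ℝ) :=
  {v | ∑ j, ε j * v j = 1 ∧ ‖v‖ ≤ 1}

theorem convex_slab {n : ℕ} (ε : Fin (n + 1) → ℝ) : Convex ℝ (slab ε) := by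
  intro x hx y hy a b ha hb hab
  refine ⟨?_, ?_⟩
  · have : ∑ j, ε j * (a • x + b • y) j = a * ∑ j, ε j * x j + b * ∑ j, ε j * y j := by
      rw [Finset.mul_sum, Finset.mul_sum, ← Finset.sum_add_distrib]
      exact Finset.sum_congr rfl fun j _ => by simp; ring
    rw [this, hx.1, hy.1, mul_one, mul_one, hab]
  · have h := convex_closedBall (0 : Fin (n + 1) → ℝ) 1 (mem_closedBall_zero_iff.2 hx.2)
      (mem_closedBall_zero_iff.2 hy.2) ha hb hab
    exact mem_closedBall_zero_iff.1 h

theorem one_le_sum_abs {n : ℕ} {ε : Fin (n + 1) → ℝ} (hε : ∀ j, |ε j| ≤ 1)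
    {v : Fin (n + 1) → ℝ} (hv : v ∈ slab ε) : 1 ≤ ∑ j, |v j| := by
  rw [← hv.1]
  refine Finset.sum_le_sum fun j _ => (le_abs_self _).trans ?_
  rw [abs_mul]
  exact mul_le_of_le_one_left (abs_nonneg _) (hε j)

/-- The `k`-th vector of the standard basis of `ℝ^(n + 1)`. -/
def stdVec (n k : ℕ) : Fin (n + 1) → ℝ := fun j => if j.val = k then 1 else 0

theorem cone_sphere_stdVec_mem_aux {n k : ℕ} (hk : k ≤ n)
    (h : sphere (stdVec n) k ∈ supportedOn fun σ => σ.length = k ∧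
      ∃ ε : Fin (n + 1) → ℝ, (∀ j, |ε j| ≤ 1) ∧
        ∀ v ∈ σ, v ∈ slab ε ∧ ∀ j : Fin (n + 1), k ≤ j.val → v j = 0) :
    cone (stdVec n k) (sphere (stdVec n) k) ∈ supportedOn fun σ => σ.length = k + 1 ∧
      ∃ ε : Fin (n + 1) → ℝ, (∀ j, |ε j| ≤ 1) ∧
        ∀ v ∈ σ, v ∈ slab ε ∧ ∀ j : Fin (n + 1), k + 1 ≤ j.val → v j = 0 := by
  refine map_mem_of ?_ h
  rintro σ ⟨hlen, ε, hε, hσ⟩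
  rw [cone_of]
  refine of_mem ⟨by simp [hlen], Function.update ε ⟨k, by omega⟩ 1, fun j => ?_, ?_⟩
  · by_cases hj : j = ⟨k, by omega⟩
    · simp [hj]
    · simpa [hj] using hε j
  · simp only [List.mem_cons, forall_eq_or_imp]
    refine ⟨⟨⟨?_, ?_⟩, fun j hj => ?_⟩, fun v hv => ⟨⟨?_, (hσ v hv).1.2⟩, fun j hj => ?_⟩⟩
    · rw [Finset.sum_eq_single ⟨k, by omega⟩]
      · simp [stdVec]
      · intro j _ hj
        have : j.val ≠ k := fun h => hj (Fin.ext h)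
        simp [stdVec, this]
      · simp
    · refine (pi_norm_le_iff_of_nonneg zero_le_one).2 fun j => ?_
      unfold stdVec
      split_ifs <;> simp
    · simp [stdVec, show j.val ≠ k by omega]
    · rw [← (hσ v hv).1.1]
      refine Finset.sum_congr rfl fun j _ => ?_
      by_cases hj : j = ⟨k, by omega⟩
      · rw [(hσ v hv).2 j (by simp [hj]), mul_zero, mul_zero]
      · simp [hj]
    · exact (hσ v hv).2 j (by omega)

theorem sphere_stdVec_mem {n k : ℕ} (hk : k ≤ n + 1) :
    sphere (stdVec n) k ∈ supportedOn fun σ => σ.length = k ∧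
      ∃ ε : Fin (n + 1) → ℝ, (∀ j, |ε j| ≤ 1) ∧
        ∀ v ∈ σ, v ∈ slab ε ∧ ∀ j : Fin (n + 1), k ≤ j.val → v j = 0 := by
  induction k with
  | zero => exact of_mem ⟨rfl, 0, by simp, by simp⟩
  | succ k ih =>
    have h := cone_sphere_stdVec_mem_aux (by omega) (ih (by omega))
    refine Submodule.add_mem _ h (map_mem_of ?_ h)
    rintro σ ⟨hlen, ε, hε, hσ⟩
    rw [antipode_of]
    refine of_mem ⟨by simp [hlen], -ε, by simpa using hε, ?_⟩
    simp only [List.mem_map, forall_exists_index, and_imp, forall_apply_eq_imp_iff₂]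
    exact fun v hv => ⟨⟨by simpa using (hσ v hv).1.1, by simpa using (hσ v hv).1.2⟩,
      fun j hj => by simpa using (hσ v hv).2 j hj⟩

theorem cone_sphere_stdVec_mem {n k : ℕ} (hk : k ≤ n) :
    cone (stdVec n k) (sphere (stdVec n) k) ∈ supportedOn fun σ =>
      ∃ ε : {ε : Fin (n + 1) → ℝ // ∀ j, |ε j| ≤ 1}, IsSmall (k + 1) (slab ε.1) 2 σ := by
  refine Finsupp.supported_mono ?_
    (cone_sphere_stdVec_mem_aux hk (sphere_stdVec_mem (by omega)))
  rintro σ ⟨hlen, ε, hε, hσ⟩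
  refine ⟨⟨ε, hε⟩, hlen, fun v hv => (hσ v hv).1, fun v hv w hw => ?_⟩
  have hv := (hσ v hv).1.2
  have hw := (hσ w hw).1.2
  linarith [dist_le_norm_add_norm v w]

end SimplexChain

/-- There is a set containing exactly one of any two distinct antipodal points. -/
theorem exists_antipodal_choice (V : Type*) [AddCommGroup V] [IsAddTorsionFree V] :
    ∃ pos : V → Prop, ∀ v, v ≠ 0 → (pos (-v) ↔ ¬ pos v) := by
  refine ⟨fun v => WellOrderingRel v (-v), fun v hv => ?_⟩
  simp only [neg_neg]
  have hne : v ≠ -v := fun h => hv (self_eq_neg.1 h)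
  constructor
  · exact fun h h' => asymm_of WellOrderingRel h h'
  · intro h
    rcases trichotomous_of WellOrderingRel v (-v) with h' | h' | h'
    exacts [absurd h' h, absurd h' hne, h']

/-- Signs of the components of an odd map, with ties broken so that they are odd as well. -/
theorem exists_odd_sign {V : Type*} [AddCommGroup V] [IsAddTorsionFree V] {n : ℕ}
    (f : V → Fin n → ℝ) (hodd : ∀ x, x ≠ 0 → f (-x) = -f x) :
    ∃ s : ℕ → V → ZMod 2, (∀ i v, v ≠ 0 → s i (-v) = s i v + 1) ∧
      ∀ (i : Fin n) v, (f v i < 0 → s i v = 0) ∧ (0 < f v i → s i v = 1) := by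
  classical
  obtain ⟨pos, hpos⟩ := exists_antipodal_choice V
  refine ⟨fun i v => if hi : i < n then
      if 0 < f v ⟨i, hi⟩ ∨ (f v ⟨i, hi⟩ = 0 ∧ pos v) then 1 else 0
    else if pos v then 1 else 0, fun i v hv => ?_, fun i v => ⟨fun h => ?_, fun h => ?_⟩⟩
  · have h11 : (1 : ZMod 2) + 1 = 0 := rfl
    by_cases hi : i < n
    · simp only [hi, dite_true, hodd v hv, Pi.neg_apply, hpos v hv]
      rcases lt_trichotomy (f v ⟨i, hi⟩) 0 with h | h | h
      · simp [h, h.ne, not_lt.2 h.le]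
      · by_cases hp : pos v <;> simp [h, hp, h11]
      · simp [h, h.ne', not_lt.2 h.le, h11]
    · simp only [hi, dite_false, hpos v hv]
      by_cases hp : pos v <;> simp [hp, h11]
  · simp [h.ne, not_lt.2 h.le]
  · simp [h]

open SimplexChain in
/-- An arbitrarily small set on which every component of an odd map changes sign. -/
theorem exists_small_simplex_sign_change {n : ℕ} (f : (Fin (n + 1) → ℝ) → Fin n → ℝ)
    (hodd : ∀ x, x ≠ 0 → f (-x) = -f x) {δ : ℝ} (hδ : 0 < δ) :
    ∃ σ : List (Fin (n + 1) → ℝ), σ ≠ [] ∧ (∀ v ∈ σ, ‖v‖ ≤ 1 ∧ 1 ≤ ∑ j, |v j|) ∧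
      (∀ v ∈ σ, ∀ w ∈ σ, dist v w < δ) ∧
      ∀ i, (∃ v ∈ σ, 0 ≤ f v i) ∧ ∃ v ∈ σ, f v i ≤ 0 := by
  obtain ⟨s, hs, hsf⟩ := exists_odd_sign f hodd
  obtain ⟨r, hr⟩ : ∃ r : ℕ, ((n : ℝ) / (n + 1)) ^ r < δ / 2 :=
    exists_pow_lt_of_lt_one (by positivity) ((div_lt_one (by positivity)).2 (by linarith))
  have hmem : ∀ k ≤ n, (subdivide (k + 1))^[r] (cone (stdVec n k) (sphere (stdVec n) k)) ∈
      supportedOn fun σ => ∃ ε : {ε : Fin (n + 1) → ℝ // ∀ j, |ε j| ≤ 1},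
        IsSmall (k + 1) (slab ε.1) (((n : ℝ) / (n + 1)) ^ r * 2) σ := fun k hk =>
    subdivide_iterate_mem (n := n)
      (C := fun ε : {ε : Fin (n + 1) → ℝ // ∀ j, |ε j| ≤ 1} => slab ε.1)
      (Nat.succ_le_succ hk) (fun ε => convex_slab ε.1) zero_le_two
      (cone_sphere_stdVec_mem hk) r
  have hne : ∀ (ε : {ε : Fin (n + 1) → ℝ // ∀ j, |ε j| ≤ 1}), ∀ v ∈ slab ε.1, v ≠ 0 := by
    rintro ε v hv rfl
    simpa using hv.1
  have hone := cupCoboundary_subdivide_cone_sphere (Q := fun v => v ≠ 0) hs (stdVec n)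
    (n := n) (r := r) (fun k hk => Finsupp.supported_mono
      (fun σ ⟨ε, hσ⟩ v hv => hne ε v (hσ.2.1 v hv)) (hmem k hk)) n le_rfl
  obtain ⟨σ, ⟨ε, hlen, hslab, hdist⟩, hσ⟩ : ∃ σ,
      (∃ ε : {ε : Fin (n + 1) → ℝ // ∀ j, |ε j| ≤ 1},
        IsSmall (n + 1) (slab ε.1) (((n : ℝ) / (n + 1)) ^ r * 2) σ) ∧
      cupCoboundary s n (of σ) ≠ 0 := by
    by_contra! h
    have h0 := eqOn_of (f := cupCoboundary s n) (g := 0) h (hmem n le_rfl)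
    rw [hone] at h0
    exact one_ne_zero h0
  have hconst : ∀ (i : Fin n) (a : ZMod 2), ¬ ∀ v ∈ σ, s i v = a := fun i a h =>
    hσ (cupCoboundary_eq_zero (Q := fun v => v ∈ σ) h i.2 _ (of_mem fun _ hv => hv))
  refine ⟨σ, by rintro rfl; simp at hlen,
    fun v hv => ⟨(hslab v hv).2, one_le_sum_abs ε.2 (hslab v hv)⟩,
    fun v hv w hw => (hdist v hv w hw).trans_lt (by linarith), fun i => ⟨?_, ?_⟩⟩
  · by_contra! h
    exact hconst i 0 fun v hv => (hsf i v).1 (h v hv)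
  · by_contra! h
    exact hconst i 1 fun v hv => (hsf i v).2 (h v hv)

/-- **Borsuk-Ulam theorem**: an odd map `ℝ^(n + 1) \ {0} → ℝ^n` has a zero. -/
theorem borsuk_ulam {n : ℕ} (f : (Fin (n + 1) → ℝ) → Fin n → ℝ)
    (hcont : ContinuousOn f {0}ᶜ) (hodd : ∀ x, x ≠ 0 → f (-x) = -f x) :
    ∃ x, x ≠ 0 ∧ f x = 0 := by
  by_contra! hf
  set K : Set (Fin (n + 1) → ℝ) := {x | ‖x‖ ≤ 1 ∧ 1 ≤ ∑ j, |x j|}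
  have hK0 : K ⊆ {0}ᶜ := by
    rintro x hx rfl
    have := hx.2
    norm_num at this
  have hK : IsCompact K := by
    refine (isCompact_closedBall (0 : Fin (n + 1) → ℝ) 1).of_isClosed_subset ?_
      fun x hx => mem_closedBall_zero_iff.2 hx.1
    exact (isClosed_le continuous_norm continuous_const).inter
      (isClosed_le continuous_const
        (continuous_finsetSum _ fun j _ => (continuous_apply j).abs))
  have hcK : ContinuousOn f K := hcont.mono hK0
  obtain ⟨m, hm, hmf⟩ : ∃ m > 0, ∀ x ∈ K, m ≤ ‖f x‖ :=
    hK.exists_forall_le' hcK.norm fun x hx => norm_pos_iff.2 (hf x (hK0 hx))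
  obtain ⟨δ, hδ, hδf⟩ :=
    Metric.uniformContinuousOn_iff.1 (hK.uniformContinuousOn_of_continuous hcK) m hm
  obtain ⟨σ, hσ, hσK, hσδ, hsign⟩ := exists_small_simplex_sign_change f hodd hδ
  obtain ⟨x, hx⟩ := List.exists_mem_of_ne_nil σ hσ
  refine (hmf x (hσK x hx)).not_gt ((pi_norm_lt_iff hm).2 fun i => ?_)
  obtain ⟨⟨v, hv, hv0⟩, w, hw, hw0⟩ := hsign i
  have key : ∀ y ∈ σ, |f x i - f y i| < m := fun y hy => by
    have := (dist_le_pi_dist (f x) (f y) i).trans_lt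
      (hδf x (hσK x hx) y (hσK y hy) (hσδ x hx y hy))
    rwa [Real.dist_eq] at this
  rw [Real.norm_eq_abs, abs_lt]
  have h₁ := abs_lt.1 (key v hv)
  have h₂ := abs_lt.1 (key w hw)
  constructor <;> linarith

section HamSandwich

variable {E : Type*} [NormedAddCommGroup E] [InnerProductSpace ℝ E] [MeasurableSpace E]

/-- The difference of the measures of the two sides of the hyperplane `{x | ⟪x, v⟫ = c}`. -/
noncomputable def sideDiff (μ : Measure E) (v : E) (c : ℝ) : ℝ :=
  ∫ x, (SignType.sign (⟪x, v⟫ - c) : ℝ) ∂μ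

theorem sideDiff_neg (μ : Measure E) (v : E) (c : ℝ) :
    sideDiff μ (-v) (-c) = -sideDiff μ v c := by
  rw [sideDiff, sideDiff, ← integral_neg]
  refine integral_congr_ae (.of_forall fun x => ?_)
  have : ⟪x, -v⟫ - -c = -(⟪x, v⟫ - c) := by rw [inner_neg_right]; ring
  simp only [this, Left.sign_neg, SignType.coe_neg]

theorem sideDiff_zero_left (μ : Measure E) (c : ℝ) :
    sideDiff μ 0 c = μ.real Set.univ * SignType.sign (-c) := by
  simp [sideDiff]

theorem measurable_coe_sign : Measurable fun t : ℝ => ((SignType.sign t : SignType) : ℝ) := by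
  have : (fun t : ℝ => ((SignType.sign t : SignType) : ℝ)) =
      fun t => if 0 < t then 1 else if t < 0 then -1 else 0 := by
    ext t
    rw [sign_apply]
    split_ifs <;> simp
  rw [this]
  exact Measurable.ite measurableSet_Ioi measurable_const
    (Measurable.ite measurableSet_Iio measurable_const measurable_const)

theorem abs_coe_sign_le (s : SignType) : |(s : ℝ)| ≤ 1 := by
  cases s <;> simp

theorem continuousAt_coe_sign {t : ℝ} (ht : t ≠ 0) :
    ContinuousAt (fun t : ℝ => ((SignType.sign t : SignType) : ℝ)) t :=
  (continuous_of_discreteTopology (f := fun s : SignType => (s : ℝ))).continuousAt.comp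
    (continuousAt_sign_of_ne_zero ht)

variable [BorelSpace E] [SecondCountableTopology E]

theorem measurable_coe_sign_inner (v : E) (c : ℝ) :
    Measurable fun x : E => (SignType.sign (⟪x, v⟫ - c) : ℝ) :=
  measurable_coe_sign.comp (by fun_prop)

theorem continuousAt_sideDiff (μ : Measure E) [IsFiniteMeasure μ] {p : E × ℝ}
    (hp : μ {x | ⟪x, p.1⟫ = p.2} = 0) :
    ContinuousAt (fun p : E × ℝ => sideDiff μ p.1 p.2) p := by
  refine continuousAt_of_dominated (bound := fun _ => 1)
    (.of_forall fun q => (measurable_coe_sign_inner q.1 q.2).aestronglyMeasurable)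
    (.of_forall fun q => .of_forall fun x => abs_coe_sign_le _) (integrable_const _) ?_
  filter_upwards [measure_eq_zero_iff_ae_notMem.1 hp] with x hx
  refine ContinuousAt.comp (g := fun t : ℝ => ((SignType.sign t : SignType) : ℝ))
    (f := fun q : E × ℝ => ⟪x, q.1⟫ - q.2) (continuousAt_coe_sign (sub_ne_zero.2 hx)) ?_
  fun_prop

theorem sideDiff_eq (μ : Measure E) [IsFiniteMeasure μ] (v : E) (c : ℝ) :
    sideDiff μ v c = μ.real {x | ⟪x, v⟫ ≥ c} - μ.real {x | ⟪x, v⟫ ≤ c} := by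
  have hge : MeasurableSet {x : E | ⟪x, v⟫ ≥ c} :=
    measurableSet_le measurable_const (by fun_prop)
  have hle : MeasurableSet {x : E | ⟪x, v⟫ ≤ c} :=
    measurableSet_le (by fun_prop) measurable_const
  rw [← integral_indicator_one hge, ← integral_indicator_one hle, ← integral_sub
    ((integrable_const 1).indicator hge) ((integrable_const 1).indicator hle), sideDiff]
  refine integral_congr_ae (.of_forall fun x => ?_)
  rcases lt_trichotomy ⟪x, v⟫ c with h | h | h
  · simp [Set.indicator, h.le, not_le.2 h, sign_neg (sub_neg.2 h)]
  · simp [Set.indicator, h]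
  · simp [Set.indicator, h.le, not_le.2 h, sign_pos (sub_pos.2 h)]

theorem measure_ge_eq_measure_le_of_sideDiff_eq_zero (μ : Measure E) [IsFiniteMeasure μ]
    {v : E} {c : ℝ} (h : sideDiff μ v c = 0) :
    μ {x | ⟪x, v⟫ ≥ c} = μ {x | ⟪x, v⟫ ≤ c} := by
  rw [sideDiff_eq, sub_eq_zero] at h
  exact (measureReal_eq_measureReal_iff).1 h

end HamSandwich

/-- **Ham sandwich theorem.** Given `d` finite measures on `ℝ^d` such that every affine
hyperplane has measure zero for each of them, there is a hyperplane
`{x : ⟪x, v⟫ = c}` (with `v` a unit vector) whose two closed half-spaces have equal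
measure for each of the `d` measures. -/
theorem ham_sandwich (d : ℕ) (hd : 1 ≤ d)
    (μ : Fin d → Measure (EuclideanSpace ℝ (Fin d)))
    [∀ i, IsFiniteMeasure (μ i)]
    (hzero : ∀ i, ∀ v : EuclideanSpace ℝ (Fin d), v ≠ 0 → ∀ c : ℝ,
      μ i {x | ⟪x, v⟫ = c} = 0) :
    ∃ (v : EuclideanSpace ℝ (Fin d)) (c : ℝ), ‖v‖ = 1 ∧
      ∀ i, μ i {x | ⟪x, v⟫ ≥ c} = μ i {x | ⟪x, v⟫ ≤ c} := by
  by_cases hμ : ∀ i, μ i = 0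
  · exact ⟨EuclideanSpace.single ⟨0, hd⟩ 1, 0, by simp, fun i => by simp [hμ i]⟩
  let vec : (Fin (d + 1) → ℝ) → EuclideanSpace ℝ (Fin d) × ℝ := fun x =>
    (WithLp.toLp 2 fun j => x j.succ, x 0)
  have hvec : Continuous vec := by fun_prop
  have hnull : ∀ x, x ≠ 0 → ∀ i, μ i {y | ⟪y, (vec x).1⟫ = (vec x).2} = 0 := by
    intro x hx i
    by_cases hv : (vec x).1 = 0
    · have hc : (vec x).2 ≠ 0 := fun hc => hx <| funext fun j =>
        Fin.cases hc (fun j => congrFun (congrArg WithLp.ofLp hv) j) j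
      simp [hv, hc.symm]
    · exact hzero i _ hv _
  obtain ⟨x, hx, hfx⟩ := borsuk_ulam (fun x i => sideDiff (μ i) (vec x).1 (vec x).2)
    (continuousOn_pi.2 fun i x hx => ((continuousAt_sideDiff (μ i) (hnull x hx i)).comp
      (f := vec) hvec.continuousAt).continuousWithinAt)
    (fun x _ => funext fun i => sideDiff_neg (μ i) (vec x).1 (vec x).2)
  have hfx : ∀ i, sideDiff (μ i) (vec x).1 (vec x).2 = 0 := congrFun hfx
  have hv : (vec x).1 ≠ 0 := by
    intro hv
    have hc : (vec x).2 ≠ 0 := fun hc => hx <| funext fun j =>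
      Fin.cases hc (fun j => congrFun (congrArg WithLp.ofLp hv) j) j
    refine hμ fun i => ?_
    have := hfx i
    rw [hv, sideDiff_zero_left, mul_eq_zero] at this
    refine Measure.measure_univ_eq_zero.1 ((measureReal_eq_zero_iff).1 (this.resolve_right ?_))
    rcases lt_or_gt_of_ne hc with h | h <;> simp [h]
  have hpos : 0 < ‖(vec x).1‖⁻¹ := inv_pos.2 (norm_pos_iff.2 hv)
  refine ⟨‖(vec x).1‖⁻¹ • (vec x).1, ‖(vec x).1‖⁻¹ * (vec x).2, norm_smul_inv_norm hv,
    fun i => ?_⟩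
  simpa [inner_smul_right, hpos] using
    measure_ge_eq_measure_le_of_sideDiff_eq_zero (μ i) (hfx i)
end

section
/- Let 1 ≤ k ≤ d be integers. Let V_k(ℝ^d) = {(v₁, …, v_k) : v₁, …, v_k are orthonormal vectors in ℝ^d} be the Stiefel manifold of orthonormal k-frames, with its subspace topology from (ℝ^d)^k. Suppose f = (f₁, …, f_k) is a continuous map with fᵢ : V_k(ℝ^d) → ℝ^{d-i} for each i = 1, …, k, which is (ℤ₂)^k-equivariant in the sense that for every sign vector (ε₁, …, ε_k) ∈ {−1, 1}^k and every frame (v₁, …, v_k), one has fᵢ(ε₁v₁, …, ε_kv_k) = εᵢ · fᵢ(v₁, …, v_k) for each i. Then f has a zero: there exists a frame (v₁, …, v_k) with fᵢ(v₁, …, v_k) = 0 for all i. -/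
open Function

/-- The mod 2 coboundary of a cochain on the cubical lattice. A cell is recorded by its doubled
barycentre `p`: odd coordinates are the directions in which the cell extends. -/
def cobd {ι : Type*} [Fintype ι] [DecidableEq ι] (F : (ι → ℤ) → ZMod 2) (p : ι → ℤ) : ZMod 2 :=
  ∑ j, if Odd (p j) then F (update p j (p j + 1)) + F (update p j (p j - 1)) else 0

/-- The cochain obtained from the indicator of the vertices by repeatedly multiplying by a
function on cells and taking the coboundary. -/
def signCochain {ι : Type*} [Fintype ι] [DecidableEq ι] :
    List ((ι → ℤ) → ZMod 2) → (ι → ℤ) → ZMod 2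
  | [], p => if ∀ j, Even (p j) then 1 else 0
  | s :: L, p => cobd (fun q => signCochain L q * s q) p

/-- A set of cells that contains all faces of its members. -/
def FaceClosed {ι : Type*} [DecidableEq ι] (A : Set (ι → ℤ)) : Prop :=
  ∀ p ∈ A, ∀ j, Odd (p j) → update p j (p j + 1) ∈ A ∧ update p j (p j - 1) ∈ A

/-- Reflection of the coordinates in `B` about `t`. -/
def reflectCell {ι : Type*} (B : ι → Prop) [DecidablePred B] (t : ℤ) (p : ι → ℤ) : ι → ℤ :=
  fun j => if B j then 2 * t - p j else p j

lemma odd_reflectCell {ι : Type*} (B : ι → Prop) [DecidablePred B] (t : ℤ) (p : ι → ℤ) (j : ι) :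
    Odd (reflectCell B t p j) ↔ Odd (p j) := by
  unfold reflectCell
  split_ifs
  · simp only [Int.odd_iff]
    lia
  · rfl

section Cochains

variable {ι : Type*} [Fintype ι] [DecidableEq ι]

lemma cobd_cobd (F : (ι → ℤ) → ZMod 2) (p : ι → ℤ) : cobd (cobd F) p = 0 := by
  have key : cobd (cobd F) p = ∑ x : ι × ι,
      if Odd (p x.1) ∧ Odd (p x.2) ∧ x.1 ≠ x.2 then
        F (update (update p x.1 (p x.1 + 1)) x.2 (p x.2 + 1)) +
        F (update (update p x.1 (p x.1 + 1)) x.2 (p x.2 - 1)) +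
        (F (update (update p x.1 (p x.1 - 1)) x.2 (p x.2 + 1)) +
        F (update (update p x.1 (p x.1 - 1)) x.2 (p x.2 - 1))) else 0 := by
    rw [Fintype.sum_prod_type]
    unfold cobd
    refine Finset.sum_congr rfl fun j _ => ?_
    by_cases hj : Odd (p j)
    · rw [if_pos hj, ← Finset.sum_add_distrib]
      refine Finset.sum_congr rfl fun i _ => ?_
      by_cases hij : j = i
      · subst hij
        have h1 : ¬ Odd (p j + 1) := by simpa [parity_simps] using hj
        have h2 : ¬ Odd (p j - 1) := by simpa [parity_simps] using hj
        simp [h1, h2]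
      · have hij' : i ≠ j := fun h => hij h.symm
        by_cases hi : Odd (p i) <;> simp [hij, hij', hi, hj]
    · simp [hj]
  rw [key]
  refine Finset.sum_involution (fun x _ => x.swap) ?_ ?_ (by simp) (by simp)
  · rintro ⟨i, j⟩ -
    by_cases h : Odd (p i) ∧ Odd (p j) ∧ i ≠ j
    · have h' : Odd (p j) ∧ Odd (p i) ∧ j ≠ i := ⟨h.2.1, h.1, h.2.2.symm⟩
      simp only [Prod.swap_prod_mk, if_pos h, if_pos h']
      simp only [update_comm h.2.2]
      generalize F (update (update p j (p j + 1)) i (p i + 1)) = a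
      generalize F (update (update p j (p j - 1)) i (p i + 1)) = b
      generalize F (update (update p j (p j + 1)) i (p i - 1)) = c
      generalize F (update (update p j (p j - 1)) i (p i - 1)) = d
      have : a + b + (c + d) + (a + c + (b + d)) = (a + b + c + d) + (a + b + c + d) := by ring
      rw [this, CharTwo.add_self_eq_zero]
    · have h' : ¬ (Odd (p j) ∧ Odd (p i) ∧ j ≠ i) := fun h' => h ⟨h'.2.1, h'.1, h'.2.2.symm⟩
      simp [h, h']
  · rintro ⟨i, j⟩ - hne heq
    apply hne
    simp only [Prod.swap_prod_mk, Prod.mk.injEq] at heq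
    simp [heq.1]

lemma cobd_signCochain (L : List ((ι → ℤ) → ZMod 2)) (p : ι → ℤ) :
    cobd (signCochain L) p = 0 := by
  cases L with
  | cons s L => exact cobd_cobd _ p
  | nil =>
    refine Finset.sum_eq_zero fun j _ => ?_
    split_ifs with hj
    · have : (∀ i, Even (update p j (p j + 1) i)) ↔ ∀ i, Even (update p j (p j - 1) i) := by
        refine forall_congr' fun i => ?_
        by_cases hij : i = j
        · subst hij; simp [parity_simps]
        · simp [hij]
      simp only [signCochain, this]
      exact CharTwo.add_self_eq_zero _
    · rfl

lemma cobd_congr {A : Set (ι → ℤ)} (hA : FaceClosed A) {F G : (ι → ℤ) → ZMod 2}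
    (h : ∀ q ∈ A, F q = G q) {p : ι → ℤ} (hp : p ∈ A) : cobd F p = cobd G p := by
  refine Finset.sum_congr rfl fun j _ => ?_
  split_ifs with hj
  · rw [h _ (hA p hp j hj).1, h _ (hA p hp j hj).2]
  · rfl

lemma cobd_mul_const (F : (ι → ℤ) → ZMod 2) (c : ZMod 2) (p : ι → ℤ) :
    cobd (fun q => F q * c) p = cobd F p * c := by
  simp only [cobd, Finset.sum_mul, ite_mul, add_mul, zero_mul]

lemma cobd_add (F G : (ι → ℤ) → ZMod 2) (p : ι → ℤ) :
    cobd (fun q => F q + G q) p = cobd F p + cobd G p := by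
  simp only [cobd, ← Finset.sum_add_distrib]
  refine Finset.sum_congr rfl fun j _ => ?_
  split_ifs
  · ring
  · simp

lemma signCochain_eq_zero_of_const {A : Set (ι → ℤ)} (hA : FaceClosed A)
    (L : List ((ι → ℤ) → ZMod 2)) (h : ∃ s ∈ L, ∃ c, ∀ q ∈ A, s q = c) :
    ∀ p ∈ A, signCochain L p = 0 := by
  induction L with
  | nil => simp at h
  | cons s' L ih =>
    intro p hp
    obtain ⟨s, hs, c, hc⟩ := h
    rcases List.mem_cons.1 hs with rfl | hs
    · change cobd (fun q => signCochain L q * s q) p = 0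
      rw [cobd_congr hA (G := fun q => signCochain L q * c) (fun q hq => by rw [hc q hq]) hp,
        cobd_mul_const, cobd_signCochain, zero_mul]
    · change cobd (fun q => signCochain L q * s' q) p = 0
      rw [cobd_congr hA (G := fun _ => 0)
        (fun q hq => by rw [ih ⟨s, hs, c, hc⟩ q hq, zero_mul]) hp]
      simp [cobd]

lemma cobd_reflectCell (B : ι → Prop) [DecidablePred B] (t : ℤ) (F : (ι → ℤ) → ZMod 2)
    (p : ι → ℤ) : cobd F (reflectCell B t p) = cobd (fun q => F (reflectCell B t q)) p := by
  refine Finset.sum_congr rfl fun j _ => ?_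
  simp only [odd_reflectCell]
  have h : ∀ x : ℤ, reflectCell B t (update p j x) =
      update (reflectCell B t p) j (if B j then 2 * t - x else x) := by
    intro x
    ext i
    by_cases hij : i = j
    · subst hij; simp [reflectCell]
    · simp [reflectCell, hij]
  simp only [h]
  by_cases hB : B j
  · simp only [reflectCell, hB, if_true]
    rw [add_comm, show 2 * t - p j + 1 = 2 * t - (p j - 1) by ring,
      show 2 * t - p j - 1 = 2 * t - (p j + 1) by ring]
  · simp [reflectCell, hB]

lemma signCochain_reflectCell {A : Set (ι → ℤ)} (hA : FaceClosed A) (B : ι → Prop)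
    [DecidablePred B] (t : ℤ) (L : List ((ι → ℤ) → ZMod 2))
    (h : ∀ s ∈ L, ∃ c, ∀ q ∈ A, s (reflectCell B t q) = s q + c) :
    ∀ p ∈ A, signCochain L (reflectCell B t p) = signCochain L p := by
  induction L with
  | nil =>
    intro p _
    have : (∀ j, Even (reflectCell B t p j)) ↔ ∀ j, Even (p j) := by
      refine forall_congr' fun j => ?_
      rw [← Int.not_odd_iff_even, ← Int.not_odd_iff_even, odd_reflectCell]
    simp only [signCochain, this]
  | cons s L ih =>
    intro p hp
    obtain ⟨c, hc⟩ := h s (by simp)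
    change cobd (fun q => signCochain L q * s q) (reflectCell B t p) =
      cobd (fun q => signCochain L q * s q) p
    rw [cobd_reflectCell, cobd_congr hA
      (G := fun q => signCochain L q * s q + signCochain L q * c) (fun q hq => ?_) hp, cobd_add,
      cobd_mul_const, cobd_signCochain, zero_mul, add_zero]
    rw [ih (fun s hs => h s (by simp [hs])) q hq, hc q hq, mul_add]

lemma signCochain_eq_zero_of_degenerate {A : Set (ι → ℤ)} (hA : FaceClosed A) (j₀ : ι)
    (L : List ((ι → ℤ) → ZMod 2))
    (h : ∀ s ∈ L, ∀ q ∈ A, ∀ x, s (update q j₀ x) = s q) :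
    ∀ p ∈ A, Odd (p j₀) → signCochain L p = 0 := by
  induction L with
  | nil =>
    intro p _ hp
    exact if_neg fun h => Int.not_even_iff_odd.2 hp (h j₀)
  | cons s L ih =>
    intro p hp hodd
    refine Finset.sum_eq_zero fun j _ => ?_
    split_ifs with hj
    · by_cases hjj : j = j₀
      · subst hjj
        have hr : update p j (p j - 1) =
            reflectCell (fun i => i = j) (p j) (update p j (p j + 1)) := by
          ext i
          by_cases hij : i = j
          · subst hij; simp [reflectCell]; ring
          · simp [reflectCell, hij]
        have hs : ∀ s' ∈ s :: L, ∀ q ∈ A,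
            s' (reflectCell (fun i => i = j) (p j) q) = s' q := by
          intro s' hs' q hq
          rw [← h s' hs' q hq (2 * p j - q j)]
          congr 1
          ext i
          by_cases hij : i = j
          · subst hij; simp [reflectCell]
          · simp [reflectCell, hij]
        have hmem := (hA p hp j hodd).1
        rw [hr]
        simp only
        rw [hs s (by simp) _ hmem, signCochain_reflectCell hA _ _ L
          (fun s' hs' => ⟨0, fun q hq => by rw [hs s' (by simp [hs']) q hq, add_zero]⟩) _ hmem]
        exact CharTwo.add_self_eq_zero _
      · have ih' := ih (fun s hs => h s (by simp [hs]))
        have hne : j₀ ≠ j := fun h => hjj h.symm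
        simp only
        rw [ih' _ (hA p hp j hj).1 (by simpa [hne] using hodd),
          ih' _ (hA p hp j hj).2 (by simpa [hne] using hodd)]
        simp
    · rfl

end Cochains

/-- The cells of the fundamental domain of a product of spheres of dimensions `a i`,
in spherical coordinates with `N` subdivisions of each angle. -/
def sphereCells {κ : Type*} [Fintype κ] [DecidableEq κ] {d : ℕ} (N : ℕ) (a : κ →₀ ℕ) :
    Finset (κ × Fin d → ℤ) :=
  Fintype.piFinset fun x =>
    if (x.2 : ℕ) < a x.1 then (Finset.range N).image (fun z : ℕ => 2 * (z : ℤ) + 1) else {0}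

section Parity

lemma sum_piFinset_update {ι : Type*} [Fintype ι] [DecidableEq ι] (S : ι → Finset ℤ) (j : ι)
    (c : ℤ) (G : (ι → ℤ) → ZMod 2) :
    ∑ p ∈ Fintype.piFinset S, G p =
      ∑ q ∈ Fintype.piFinset (update S j {c}), ∑ x ∈ S j, G (update q j x) := by
  rw [← Finset.sum_product']
  refine Finset.sum_nbij' (fun p => (update p j c, p j)) (fun y => update y.1 j y.2) ?_ ?_ ?_ ?_ ?_
  · intro p hp
    rw [Fintype.mem_piFinset] at hp
    simp only [Finset.mem_product, Fintype.mem_piFinset]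
    refine ⟨fun i => ?_, hp j⟩
    by_cases hij : i = j
    · subst hij; simp
    · simpa [hij] using hp i
  · rintro ⟨q, x⟩ hq
    simp only [Finset.mem_product, Fintype.mem_piFinset] at hq ⊢
    intro i
    by_cases hij : i = j
    · subst hij; simpa using hq.2
    · simpa [hij] using hq.1 i
  · intro p _
    simp
  · rintro ⟨q, x⟩ hq
    simp only [Finset.mem_product, Fintype.mem_piFinset] at hq
    have : q j = c := by simpa using hq.1 j
    simp [← this]
  · intro p _
    simp

lemma sum_odd_telescope (N : ℕ) (h : ℤ → ZMod 2) :
    ∑ x ∈ (Finset.range N).image (fun z : ℕ => 2 * (z : ℤ) + 1), (h (x + 1) + h (x - 1)) =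
      h (2 * N) + h 0 := by
  rw [Finset.sum_image (fun x _ y _ hxy => by simpa using hxy)]
  induction N with
  | zero => simp [CharTwo.add_self_eq_zero]
  | succ N ih =>
    rw [Finset.sum_range_succ, ih]
    have h1 : 2 * (N : ℤ) + 1 + 1 = 2 * ((N + 1 : ℕ) : ℤ) := by push_cast; ring
    have h2 : 2 * (N : ℤ) + 1 - 1 = 2 * (N : ℤ) := by ring
    rw [h1, h2]
    have : h (2 * N) + h 0 + (h (2 * ((N + 1 : ℕ) : ℤ)) + h (2 * N)) =
      h (2 * ((N + 1 : ℕ) : ℤ)) + h 0 + (h (2 * N) + h (2 * N)) := by ring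
    rw [this, CharTwo.add_self_eq_zero, add_zero]

variable {κ : Type*} [Fintype κ] [DecidableEq κ] {d : ℕ}

/-- A function on cells that is compatible with the identifications of spherical coordinates:
when a polar angle is `0` or `π`, the later angles are irrelevant, and the two poles are exchanged
by reversing the earlier angles, which changes the value by the character `χ`. -/
structure IsSphereSign (N : ℕ) (s : (κ × Fin d → ℤ) → ZMod 2) (χ : κ → ZMod 2) : Prop where
  degenerate : ∀ (p : κ × Fin d → ℤ) (i : κ) (l l' : Fin d) (x : ℤ), l < l' → p (i, l) = 0 ∨ p (i, l) = 2 * N →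
    s (update p (i, l') x) = s p
  antipodal : ∀ (p : κ × Fin d → ℤ) (i : κ) (l : Fin d), p (i, l) = 0 →
    s (reflectCell (fun y => y.1 = i ∧ y.2 ≤ l) N p) = s p + χ i

lemma faceClosed_eq_even {ι : Type*} [DecidableEq ι] (j : ι) (c : ℤ) (hc : Even c) :
    FaceClosed {p : ι → ℤ | p j = c} := by
  intro p hp i hi
  have hij : j ≠ i := by
    rintro rfl
    rw [Set.mem_ofPred_eq] at hp
    rw [hp] at hi
    exact Int.not_even_iff_odd.2 hi hc
  simpa [hij] using hp

lemma odd_of_mem_sphereCells {N : ℕ} {a : κ →₀ ℕ} {p : κ × Fin d → ℤ}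
    (hp : p ∈ sphereCells N a) {i : κ} {l : Fin d} (hl : (l : ℕ) < a i) : Odd (p (i, l)) := by
  have := Fintype.mem_piFinset.1 hp (i, l)
  simp only [hl, if_true, Finset.mem_image] at this
  obtain ⟨z, _, hz⟩ := this
  exact ⟨z, hz.symm⟩

lemma eq_zero_of_mem_sphereCells {N : ℕ} {a : κ →₀ ℕ} {p : κ × Fin d → ℤ}
    (hp : p ∈ sphereCells N a) {i : κ} {l : Fin d} (hl : ¬ (l : ℕ) < a i) : p (i, l) = 0 := by
  have := Fintype.mem_piFinset.1 hp (i, l)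
  simpa [hl] using this

lemma sum_sphereCells_face (N : ℕ) (a : κ →₀ ℕ) (F : (κ × Fin d → ℤ) → ZMod 2) (i : κ)
    (l : Fin d) (hl : (l : ℕ) < a i) :
    (∑ p ∈ sphereCells N a, if Odd (p (i, l)) then
      F (update p (i, l) (p (i, l) + 1)) + F (update p (i, l) (p (i, l) - 1)) else 0) =
    ∑ q ∈ Fintype.piFinset (update (fun x : κ × Fin d =>
        if (x.2 : ℕ) < a x.1 then (Finset.range N).image (fun z : ℕ => 2 * (z : ℤ) + 1) else {0})
        (i, l) {0}), (F (update q (i, l) (2 * N)) + F (update q (i, l) 0)) := by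
  rw [Finset.sum_congr rfl fun p hp => if_pos (odd_of_mem_sphereCells hp hl)]
  unfold sphereCells
  rw [sum_piFinset_update _ (i, l) 0]
  refine Finset.sum_congr rfl fun q _ => ?_
  simp only [hl, if_true, update_self, update_idem]
  exact sum_odd_telescope N fun x => F (update q (i, l) x)

lemma sum_sphereCells_reflect (N : ℕ) (a : κ →₀ ℕ) (F : (κ × Fin d → ℤ) → ZMod 2) (i : κ)
    (l : Fin d) (hl : a i = l) :
    ∑ q ∈ sphereCells N a, F (update q (i, l) (2 * N)) =
      ∑ q ∈ sphereCells N a, F (reflectCell (fun y => y.1 = i ∧ y.2 ≤ l) N q) := by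
  have hmem : ∀ q ∈ sphereCells (d := d) N a,
      reflectCell (fun y => y.1 = i ∧ y.2 < l) N q ∈ sphereCells N a := by
    intro q hq
    refine Fintype.mem_piFinset.2 fun x => ?_
    have hx := Fintype.mem_piFinset.1 hq x
    by_cases hB : x.1 = i ∧ x.2 < l
    · have hlt : (x.2 : ℕ) < a x.1 := by rw [hB.1, hl]; exact hB.2
      simp only [hlt, if_true, Finset.mem_image, Finset.mem_range] at hx ⊢
      obtain ⟨z, hz, hzx⟩ := hx
      refine ⟨N - 1 - z, by lia, ?_⟩
      simp only [reflectCell, hB, and_self, if_true]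
      rw [← hzx]
      lia
    · simpa only [reflectCell, hB, if_false] using hx
  have hinv : ∀ q : κ × Fin d → ℤ, reflectCell (fun y => y.1 = i ∧ y.2 < l) N
      (reflectCell (fun y => y.1 = i ∧ y.2 < l) N q) = q := by
    intro q
    ext x
    unfold reflectCell
    split_ifs
    · ring
    · rfl
  refine Finset.sum_nbij' (reflectCell (fun y => y.1 = i ∧ y.2 < l) N)
    (reflectCell (fun y => y.1 = i ∧ y.2 < l) N) hmem hmem
    (fun q _ => hinv q) (fun q _ => hinv q) ?_
  intro q hq
  congr 1
  ext x
  by_cases hx : x = (i, l)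
  · subst hx
    have := eq_zero_of_mem_sphereCells (hmem q hq) (i := i) (l := l) (by simp [hl])
    simp [reflectCell] at this ⊢
    lia
  · have hne : (x.1 = i ∧ x.2 ≤ l) ↔ (x.1 = i ∧ x.2 < l) := by
      refine and_congr_right fun hi => ⟨fun h => lt_of_le_of_ne h fun h' => hx ?_, le_of_lt⟩
      exact Prod.ext hi h'
    rw [update_of_ne hx]
    by_cases h : x.1 = i ∧ x.2 < l
    · simp [reflectCell, h, h.2.le]
    · rw [reflectCell, if_neg (hne.not.2 (by simpa using h))]
      simp [reflectCell, h]

lemma sum_sphereCells_cons (N : ℕ) (L : List (((κ × Fin d → ℤ) → ZMod 2) × (κ → ZMod 2)))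
    (s : (κ × Fin d → ℤ) → ZMod 2) (χ : κ → ZMod 2) (hs : IsSphereSign N s χ)
    (hL : ∀ y ∈ L, IsSphereSign N y.1 y.2) (a : κ →₀ ℕ) (ha : ∀ i, a i ≤ d) :
    ∑ p ∈ sphereCells N a, signCochain (s :: L.map Prod.fst) p =
      ∑ i, if i ∈ a.support then
        χ i * ∑ p ∈ sphereCells N (a - Finsupp.single i 1), signCochain (L.map Prod.fst) p
        else 0 := by
  set F : (κ × Fin d → ℤ) → ZMod 2 := fun q => signCochain (L.map Prod.fst) q * s q with hF
  change ∑ p ∈ sphereCells N a, cobd F p = _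
  unfold cobd
  rw [Finset.sum_comm, Fintype.sum_prod_type]
  refine Finset.sum_congr rfl fun i _ => ?_
  have hzero : ∀ l : Fin d, (l : ℕ) + 1 ≠ a i → (∑ p ∈ sphereCells N a, if Odd (p (i, l)) then
      F (update p (i, l) (p (i, l) + 1)) + F (update p (i, l) (p (i, l) - 1)) else 0) = 0 := by
    intro l hla
    by_cases hl : (l : ℕ) < a i
    · rw [sum_sphereCells_face N a F i l hl]
      refine Finset.sum_eq_zero fun q hq => ?_
      have hl1 : (l : ℕ) + 1 < a i := by lia
      set l' : Fin d := ⟨l + 1, hl1.trans_le (ha i)⟩ with hl'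
      have hll : l < l' := by simp [hl', Fin.lt_def]
      have hne : (i, l') ≠ (i, l) := by
        intro h
        exact hll.ne' (congrArg Prod.snd h)
      have hodd : Odd (q (i, l')) := by
        have := Fintype.mem_piFinset.1 hq (i, l')
        rw [update_of_ne hne, if_pos (by simpa [hl'] using hl1)] at this
        obtain ⟨z, _, hz⟩ := Finset.mem_image.1 this
        exact ⟨z, hz.symm⟩
      have hvan : ∀ c : ℤ, c = 0 ∨ c = 2 * N → F (update q (i, l) c) = 0 := by
        intro c hc
        have hev : Even c := by
          rcases hc with rfl | rfl <;> simp
        have := signCochain_eq_zero_of_degenerate (faceClosed_eq_even (i, l) c hev) (i, l')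
          (L.map Prod.fst) (fun s' hs' p hp x => by
            obtain ⟨y, hy, rfl⟩ := List.mem_map.1 hs'
            exact (hL y hy).degenerate p i l l' x hll (by rw [hp]; exact hc))
          (update q (i, l) c) (by simp) (by simpa [hne] using hodd)
        simp only [hF, this, zero_mul]
      rw [hvan _ (Or.inr rfl), hvan _ (Or.inl rfl), add_zero]
    · refine Finset.sum_eq_zero fun p hp => ?_
      rw [eq_zero_of_mem_sphereCells hp hl]
      simp
  split_ifs with hi
  · have hi' : a i ≠ 0 := Finsupp.mem_support_iff.1 hi
    set l : Fin d := ⟨a i - 1, by have := ha i; lia⟩ with hl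
    have hla : (l : ℕ) + 1 = a i := by simp only [hl]; lia
    rw [Finset.sum_eq_single l (fun l' _ hl' => hzero l' fun h => hl' (Fin.ext (by lia)))
      (by simp), sum_sphereCells_face N a F i l (by lia)]
    set b := a - Finsupp.single i 1 with hb
    have hbi : b i = l := by simp [hb, hl]
    have hcells : Fintype.piFinset (update (fun x : κ × Fin d =>
        if (x.2 : ℕ) < a x.1 then (Finset.range N).image (fun z : ℕ => 2 * (z : ℤ) + 1) else {0})
        (i, l) {0}) = sphereCells N b := by
      unfold sphereCells
      congr 1
      ext1 x
      by_cases hx : x = (i, l)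
      · subst hx; simp [hbi]
      · rw [update_of_ne hx]
        congr 1
        by_cases hxi : x.1 = i
        · have : x.2 ≠ l := fun h => hx (Prod.ext hxi h)
          have : (x.2 : ℕ) ≠ l := fun h => this (Fin.ext h)
          rw [hxi, hbi, eq_iff_iff]
          lia
        · have : b x.1 = a x.1 := by simp [hb, Ne.symm hxi]
          rw [this]
    rw [hcells, Finset.sum_add_distrib, sum_sphereCells_reflect N b F i l hbi,
      ← Finset.sum_add_distrib, Finset.mul_sum]
    refine Finset.sum_congr rfl fun q hq => ?_
    have hq0 : q (i, l) = 0 := eq_zero_of_mem_sphereCells hq (by simp [hbi])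
    have hupd : update q (i, l) 0 = q := by rw [← hq0]; simp
    rw [hupd]
    simp only [hF]
    rw [hs.antipodal q i l hq0, signCochain_reflectCell (faceClosed_eq_even (i, l) 0 (by simp)) _ _
      (L.map Prod.fst) (fun s' hs' => ?_) q hq0]
    · have : ∀ x y z : ZMod 2, x * (y + z) + x * y = z * x := by decide
      exact this _ _ _
    · obtain ⟨y, hy, rfl⟩ := List.mem_map.1 hs'
      exact ⟨y.2 i, fun p hp => (hL y hy).antipodal p i l hp⟩
  · refine Finset.sum_eq_zero fun l _ => hzero l ?_
    rw [Finsupp.notMem_support_iff.1 hi]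
    lia

lemma sum_sphereCells_eq_coeff (N : ℕ)
    (L : List (((κ × Fin d → ℤ) → ZMod 2) × (κ → ZMod 2)))
    (hL : ∀ y ∈ L, IsSphereSign N y.1 y.2) (a : κ →₀ ℕ) (ha : ∀ i, a i ≤ d) :
    ∑ p ∈ sphereCells N a, signCochain (L.map Prod.fst) p =
      MvPolynomial.coeff a (L.map fun y => ∑ i, MvPolynomial.C (y.2 i) * MvPolynomial.X i).prod := by
  induction L generalizing a with
  | nil =>
    simp only [List.map_nil, List.prod_nil, MvPolynomial.coeff_one]
    split_ifs with h
    · subst h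
      have : sphereCells (d := d) N (0 : κ →₀ ℕ) = {0} := by
        ext p
        simp [sphereCells, funext_iff]
      rw [this, Finset.sum_singleton]
      simp [signCochain]
    · refine Finset.sum_eq_zero fun p hp => if_neg fun hev => h ?_
      ext i
      by_contra hi
      have hi' : 0 < a i := Nat.pos_of_ne_zero fun h => hi h.symm
      exact Int.not_even_iff_odd.2 (odd_of_mem_sphereCells hp (i := i)
        (l := ⟨0, hi'.trans_le (ha i)⟩) hi') (hev _)
  | cons y L ih =>
    obtain ⟨s, χ⟩ := y
    rw [List.map_cons, List.map_cons, List.prod_cons,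
      sum_sphereCells_cons N L s χ (hL (s, χ) (by simp)) (fun y hy => hL y (by simp [hy])) a ha,
      Finset.sum_mul, MvPolynomial.coeff_sum]
    refine Finset.sum_congr rfl fun i _ => ?_
    rw [mul_assoc, MvPolynomial.coeff_C_mul, MvPolynomial.coeff_X_mul',
      ih (fun y hy => hL y (by simp [hy])) _ fun j => (Nat.sub_le _ _).trans (ha j)]
    simp

end Parity

/-- Spherical coordinates. The result is a unit vector as soon as some angle is a multiple of
`π`, for instance the last one, which plays no role otherwise. -/
noncomputable def polar {d : ℕ} (θ : Fin d → ℝ) : EuclideanSpace ℝ (Fin d) :=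
  WithLp.toLp 2 fun l => (∏ m ∈ Finset.univ.filter (· < l), Real.sin (θ m)) * Real.cos (θ l)

section Sphere

lemma polar_apply {d : ℕ} (θ : Fin d → ℝ) (l : Fin d) :
    polar θ l = (∏ m ∈ Finset.univ.filter (· < l), Real.sin (θ m)) * Real.cos (θ l) := rfl

lemma continuous_polar {d : ℕ} : Continuous (polar (d := d)) := by
  unfold polar
  fun_prop

lemma norm_polar {d : ℕ} (θ : Fin d → ℝ) {l : Fin d} (hl : Real.sin (θ l) = 0) :
    ‖polar θ‖ = 1 := by
  have h := Finset.prod_one_sub_ordered (Finset.univ : Finset (Fin d))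
    (fun m => Real.cos (θ m) ^ 2)
  have h0 : ∏ m : Fin d, (1 - Real.cos (θ m) ^ 2) = 0 :=
    Finset.prod_eq_zero (Finset.mem_univ l) (by rw [← Real.sin_sq, hl]; simp)
  rw [h0] at h
  have hsq : ‖polar θ‖ ^ 2 = 1 := by
    rw [EuclideanSpace.norm_sq_eq, eq_comm, ← sub_eq_zero, eq_comm, h]
    congr 1
    refine Finset.sum_congr rfl fun m _ => ?_
    rw [polar_apply, Real.norm_eq_abs, sq_abs, mul_pow, ← Finset.prod_pow, mul_comm]
    simp only [Real.sin_sq]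
  exact (pow_eq_one_iff_of_nonneg (norm_nonneg _) two_ne_zero).1 hsq

lemma polar_congr {d : ℕ} {θ η : Fin d → ℝ} {l : Fin d} (hl : Real.sin (θ l) = 0)
    (h : ∀ m ≤ l, η m = θ m) : polar η = polar θ := by
  ext m
  rw [polar_apply, polar_apply]
  rcases le_or_gt m l with hm | hm
  · rw [h m hm]
    congr 1
    refine Finset.prod_congr rfl fun i hi => ?_
    rw [h i ((Finset.mem_filter.1 hi).2.le.trans hm)]
  · rw [Finset.prod_eq_zero (i := l) (by simpa using hm) (by rw [h l le_rfl, hl]),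
      Finset.prod_eq_zero (i := l) (by simpa using hm) hl, zero_mul, zero_mul]

lemma polar_antipodal {d : ℕ} {θ η : Fin d → ℝ} {l : Fin d} (hl : Real.sin (θ l) = 0)
    (h : ∀ m ≤ l, η m = Real.pi - θ m) : polar η = - polar θ := by
  ext m
  rw [PiLp.neg_apply, polar_apply, polar_apply]
  rcases le_or_gt m l with hm | hm
  · rw [h m hm, Real.cos_pi_sub, mul_neg]
    congr 2
    refine Finset.prod_congr rfl fun i hi => ?_
    rw [h i ((Finset.mem_filter.1 hi).2.le.trans hm), Real.sin_pi_sub]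
  · rw [Finset.prod_eq_zero (i := l) (by simpa using hm) (by rw [h l le_rfl, Real.sin_pi_sub, hl]),
      Finset.prod_eq_zero (i := l) (by simpa using hm) hl, zero_mul, zero_mul, neg_zero]

lemma exists_orientation (d : ℕ) : ∃ τ : EuclideanSpace ℝ (Fin d) → ZMod 2,
    ∀ v, v ≠ 0 → τ (-v) = τ v + 1 := by
  classical
  refine ⟨fun v => if 0 < toLex (WithLp.ofLp v) then 1 else 0, fun v hv => ?_⟩
  have hv' : toLex (WithLp.ofLp v) ≠ 0 := fun h => hv (by
    ext i
    exact congrFun (toLex.injective h) i)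
  have hneg : toLex (WithLp.ofLp (-v)) = - toLex (WithLp.ofLp v) := rfl
  simp only [hneg]
  rcases lt_or_gt_of_ne hv' with h | h <;> split_ifs with h1 h2 h2
  · exact absurd h2 h.not_gt
  · rw [zero_add]
  · exact absurd (neg_pos.2 h) h1
  · exact absurd (neg_pos.2 h) h1
  · exact absurd h1 (neg_neg_of_pos h).not_gt
  · exact absurd h h2
  · rw [CharTwo.add_self_eq_zero]
  · exact absurd h h2

lemma exists_sign {κ : Type*} [Fintype κ] [DecidableEq κ] {d : ℕ} (χ : κ → ZMod 2)
    (g : (κ → EuclideanSpace ℝ (Fin d)) → ℝ)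
    (hg : ∀ i x, g (update x i (-x i)) = if χ i = 0 then g x else - g x) :
    ∃ σ : (κ → EuclideanSpace ℝ (Fin d)) → ZMod 2,
      (∀ x, 0 < g x → σ x = 1) ∧ (∀ x, g x < 0 → σ x = 0) ∧
      ∀ i x, x i ≠ 0 → σ (update x i (-x i)) = σ x + χ i := by
  obtain ⟨τ, hτ⟩ := exists_orientation d
  refine ⟨fun x => if 0 < g x then 1 else if g x < 0 then 0 else ∑ i, χ i * τ (x i),
    fun x hx => if_pos hx, fun x hx => ?_, fun i x hx => ?_⟩
  · simp only [if_neg hx.not_gt, if_pos hx]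
  · have h01 : ∀ c : ZMod 2, c = 0 ∨ c = 1 := by decide
    simp only [hg]
    rcases lt_trichotomy (g x) 0 with h | h | h
    · rcases h01 (χ i) with hc | hc <;> simp [hc, h, h.not_gt]
    · simp only [h, neg_zero, ite_self, lt_irrefl, if_false]
      rw [← Finset.add_sum_erase _ _ (Finset.mem_univ i),
        ← Finset.add_sum_erase _ (fun m => χ m * τ (x m)) (Finset.mem_univ i), update_self, hτ _ hx,
        Finset.sum_congr rfl fun m hm => by rw [update_of_ne (Finset.ne_of_mem_erase hm)]]
      ring
    · rcases h01 (χ i) with hc | hc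
      · simp [hc, h]
      · simp [hc, h, h.not_gt, CharTwo.add_self_eq_zero]

/-- The point of the product of spheres at the barycentre of a cell. -/
noncomputable def cellPoint {κ : Type*} {d : ℕ} (N : ℕ) (p : κ × Fin d → ℤ) :
    κ → EuclideanSpace ℝ (Fin d) :=
  fun i => polar fun l => Real.pi * p (i, l) / (2 * N)

lemma isSphereSign_cellPoint {κ : Type*} [Fintype κ] [DecidableEq κ] {d N : ℕ} (hN : 0 < N)
    {χ : κ → ZMod 2} {σ : (κ → EuclideanSpace ℝ (Fin d)) → ZMod 2}
    (hσ : ∀ i x, x i ≠ 0 → σ (update x i (-x i)) = σ x + χ i) :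
    IsSphereSign N (fun p => σ (cellPoint N p)) χ := by
  have hN0 : (N : ℝ) ≠ 0 := by positivity
  have hwall : ∀ c : ℤ, c = 0 ∨ c = 2 * N → Real.sin (Real.pi * c / (2 * N)) = 0 := by
    rintro c (rfl | rfl)
    · simp
    · push_cast
      rw [mul_div_cancel_right₀ _ (by positivity), Real.sin_pi]
  constructor
  · intro p i l l' x hll hp
    refine congrArg σ (funext fun i' => ?_)
    by_cases hi : i' = i
    · subst hi
      refine polar_congr (l := l) (hwall _ hp) fun m hm => ?_
      have : (i', m) ≠ (i', l') := fun h => (hm.trans_lt hll).ne (congrArg Prod.snd h)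
      rw [update_of_ne this]
    · refine congrArg polar (funext fun m => ?_)
      have : (i', m) ≠ (i, l') := fun h => hi (congrArg Prod.fst h)
      rw [update_of_ne this]
  · intro p i l hp
    have hsin := hwall (p (i, l)) (Or.inl hp)
    have hnorm : ‖cellPoint N p i‖ = 1 :=
      norm_polar (fun m => Real.pi * p (i, m) / (2 * N)) (l := l) hsin
    have hne : cellPoint N p i ≠ 0 := by
      intro h
      rw [h, norm_zero] at hnorm
      exact zero_ne_one hnorm
    change σ (cellPoint N _) = σ (cellPoint N p) + χ i
    rw [← hσ i _ hne]
    refine congrArg σ (funext fun i' => ?_)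
    by_cases hi : i' = i
    · subst hi
      rw [update_self]
      refine polar_antipodal (l := l) hsin fun m hm => ?_
      have : reflectCell (fun y : κ × Fin d => y.1 = i' ∧ y.2 ≤ l) N p (i', m) =
          2 * N - p (i', m) := if_pos ⟨rfl, hm⟩
      rw [this]
      push_cast
      field_simp
    · rw [update_of_ne hi]
      refine congrArg polar (funext fun m => ?_)
      have : reflectCell (fun y : κ × Fin d => y.1 = i ∧ y.2 ≤ l) N p (i', m) = p (i', m) :=
        if_neg fun h => hi h.1
      rw [this]

/-- A Borsuk–Ulam theorem for products of spheres: a system of functions, each of which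
changes sign under the antipodal maps according to a character, has a common zero if the
product of the linear forms attached to the characters has a nonzero top coefficient mod 2. -/
theorem exists_common_zero_of_coeff_ne_zero {κ J : Type*} [Fintype κ] [DecidableEq κ] [Fintype J]
    {d : ℕ} (hd : 0 < d) (χ : J → κ → ZMod 2) (g : J → (κ → EuclideanSpace ℝ (Fin d)) → ℝ)
    (hcont : ∀ j, Continuous (g j))
    (hodd : ∀ j i x, g j (update x i (-x i)) = if χ j i = 0 then g j x else - g j x)
    (hcoeff : MvPolynomial.coeff (Finsupp.equivFunOnFinite.symm fun _ => d - 1)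
      (∏ j, ∑ i, MvPolynomial.C (χ j i) * MvPolynomial.X i) ≠ 0) :
    ∃ x, (∀ i, ‖x i‖ = 1) ∧ ∀ j, g j x = 0 := by
  by_contra! hno
  choose σ hpos hneg hflip using fun j => exists_sign (χ j) (g j) (hodd j)
  set Φ : (κ × Fin d → ℝ) → κ → EuclideanSpace ℝ (Fin d) :=
    fun θ i => polar fun l => θ (i, l) with hΦ
  have hΦc : Continuous Φ := continuous_pi fun i => continuous_polar.comp (by fun_prop)
  set K : Set (κ × Fin d → ℝ) :=
    Set.pi Set.univ fun x => if (x.2 : ℕ) < d - 1 then Set.Icc 0 Real.pi else {0} with hK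
  have hKc : IsCompact K := isCompact_univ_pi fun x => by
    split_ifs
    · exact isCompact_Icc
    · exact isCompact_singleton
  set last : Fin d := ⟨d - 1, by lia⟩ with hlast
  let U : J × Bool → Set (κ × Fin d → ℝ) := fun y =>
    if y.2 then {θ | 0 < g y.1 (Φ θ)} else {θ | g y.1 (Φ θ) < 0}
  obtain ⟨δ, hδ, hball⟩ := lebesgue_number_lemma_of_metric (c := U) hKc
    (by
      rintro ⟨j, b⟩
      cases b
      · exact isOpen_lt ((hcont j).comp hΦc) continuous_const
      · exact isOpen_lt continuous_const ((hcont j).comp hΦc))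
    (by
      intro θ hθ
      have hunit : ∀ i, ‖Φ θ i‖ = 1 := fun i => by
        have : θ (i, last) = 0 := by simpa [hlast] using hθ (i, last) (Set.mem_univ _)
        exact norm_polar _ (l := last) (by simp [this])
      obtain ⟨j, hj⟩ := hno _ hunit
      rcases lt_or_gt_of_ne hj with h | h
      · exact Set.mem_iUnion.2 ⟨(j, false), h⟩
      · exact Set.mem_iUnion.2 ⟨(j, true), h⟩)
  obtain ⟨n, hn⟩ := exists_nat_gt (Real.pi / (2 * δ))
  set N : ℕ := n + 1 with hN
  have hN0 : (0 : ℝ) < N := by positivity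
  have hNδ : Real.pi / (2 * N) < δ := by
    rw [div_lt_iff₀ (by positivity)] at hn ⊢
    have : (n : ℝ) < N := by simp [hN]
    nlinarith
  let Θ : (κ × Fin d → ℤ) → κ × Fin d → ℝ := fun p x => Real.pi * p x / (2 * N)
  have hsign : ∀ j, IsSphereSign N (fun p => σ j (Φ (Θ p))) (χ j) :=
    fun j => isSphereSign_cellPoint n.succ_pos (hflip j)
  set a : κ →₀ ℕ := Finsupp.equivFunOnFinite.symm fun _ => d - 1 with ha
  have hsum := sum_sphereCells_eq_coeff N
    ((Finset.univ : Finset J).toList.map fun j => (fun p => σ j (Φ (Θ p)), χ j))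
    (by
      intro y hy
      obtain ⟨j, _, rfl⟩ := List.mem_map.1 hy
      exact hsign j) a (fun i => by simp [ha])
  rw [List.map_map, List.map_map, Function.comp_def, Function.comp_def] at hsum
  simp only [Finset.prod_map_toList] at hsum
  refine hcoeff (hsum.symm.trans (Finset.sum_eq_zero fun p hp => ?_))
  have hmem : Θ p ∈ K := by
    intro x _
    have hx := Fintype.mem_piFinset.1 hp x
    by_cases hxd : (x.2 : ℕ) < d - 1
    · have hxa : (x.2 : ℕ) < a x.1 := by simpa [ha] using hxd
      rw [if_pos hxa] at hx
      simp only [Finset.mem_image, Finset.mem_range] at hx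
      obtain ⟨z, hz, hzx⟩ := hx
      have h0 : (0 : ℝ) ≤ p x := by exact_mod_cast (by lia : 0 ≤ p x)
      have h1 : (p x : ℝ) ≤ 2 * N := by exact_mod_cast (by lia : p x ≤ 2 * (N : ℤ))
      simp only [if_pos hxd]
      constructor
      · have := Real.pi_pos
        simp only [Θ]
        positivity
      · simp only [Θ]
        rw [div_le_iff₀ (by positivity)]
        exact mul_le_mul_of_nonneg_left h1 Real.pi_pos.le
    · have hxa : ¬ (x.2 : ℕ) < a x.1 := by simpa [ha] using hxd
      rw [if_neg hxa, Finset.mem_singleton] at hx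
      simp [hxd, Θ, hx]
  obtain ⟨⟨j, b⟩, hjb⟩ := hball _ hmem
  let A : Set (κ × Fin d → ℤ) :=
    {q | ∀ x, q x = p x ∨ Odd (p x) ∧ (q x = p x + 1 ∨ q x = p x - 1)}
  have hA : FaceClosed A := by
    intro q hq x hx
    have hqx : Odd (p x) ∧ q x = p x := by
      rcases hq x with h | ⟨h, h' | h'⟩
      · exact ⟨h ▸ hx, h⟩
      · rw [h'] at hx
        simp only [Int.odd_iff] at hx h
        lia
      · rw [h'] at hx
        simp only [Int.odd_iff] at hx h
        lia
    constructor <;> intro y <;> by_cases hy : y = x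
    · subst hy; simp [hqx]
    · simpa [hy] using hq y
    · subst hy; simp [hqx]
    · simpa [hy] using hq y
  have hclose : ∀ q ∈ A, Θ q ∈ U (j, b) := by
    intro q hq
    refine hjb (Metric.mem_ball.2 (lt_of_le_of_lt ?_ hNδ))
    refine (dist_pi_le_iff (by positivity)).2 fun x => ?_
    have hqp : |(q x : ℝ) - p x| ≤ 1 := by
      have : |q x - p x| ≤ 1 := by
        rw [abs_le]
        rcases hq x with h | ⟨-, h | h⟩ <;> lia
      exact_mod_cast this
    have : Θ q x - Θ p x = Real.pi / (2 * N) * ((q x : ℝ) - p x) := by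
      simp only [Θ]
      ring
    rw [Real.dist_eq, this, abs_mul, abs_of_pos (by positivity)]
    exact mul_le_of_le_one_right (by positivity) hqp
  refine signCochain_eq_zero_of_const hA _ ⟨fun p => σ j (Φ (Θ p)), ?_, if b then 1 else 0, ?_⟩
    p fun x => Or.inl rfl
  · exact List.mem_map.2 ⟨j, by simp, rfl⟩
  · intro q hq
    have := hclose q hq
    cases b
    · exact hneg j _ this
    · exact hpos j _ this

end Sphere

section Stiefel

lemma prod_X_pow_eq_monomial_equivFunOnFinite {κ R : Type*} [Fintype κ] [CommSemiring R]
    (n : κ → ℕ) : ∏ i, (MvPolynomial.X i : MvPolynomial κ R) ^ n i =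
      MvPolynomial.monomial (Finsupp.equivFunOnFinite.symm n) 1 := by
  rw [MvPolynomial.monomial_eq, Finsupp.prod_fintype _ _ (fun i => pow_zero _), map_one, one_mul]
  rfl

lemma coeff_prod_X_add_X (k : ℕ) :
    MvPolynomial.coeff (Finsupp.equivFunOnFinite.symm fun i : Fin k => (i : ℕ))
      (∏ i : Fin k, ∏ j ∈ Finset.Ioi i,
        (MvPolynomial.X i + MvPolynomial.X j : MvPolynomial (Fin k) (ZMod 2))) = 1 := by
  have hdet : (∏ i : Fin k, ∏ j ∈ Finset.Ioi i,
      (MvPolynomial.X i + MvPolynomial.X j : MvPolynomial (Fin k) (ZMod 2))) =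
      (Matrix.vandermonde fun i => (MvPolynomial.X i : MvPolynomial (Fin k) (ZMod 2))).det := by
    rw [Matrix.det_vandermonde]
    simp only [CharTwo.sub_eq_add, add_comm]
  have hmon : ∀ τ : Equiv.Perm (Fin k),
      ∏ i, Matrix.vandermonde (fun i => (MvPolynomial.X i : MvPolynomial (Fin k) (ZMod 2)))
        (τ i) i = MvPolynomial.monomial
          (Finsupp.equivFunOnFinite.symm fun i => ((τ.symm i : Fin k) : ℕ)) 1 := by
    intro τ
    rw [← prod_X_pow_eq_monomial_equivFunOnFinite, ← Equiv.prod_comp τ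
      fun j => (MvPolynomial.X j : MvPolynomial (Fin k) (ZMod 2)) ^ ((τ.symm j : Fin k) : ℕ)]
    simp [Matrix.vandermonde_apply]
  rw [hdet, Matrix.det_apply, MvPolynomial.coeff_sum, Finset.sum_eq_single 1]
  · rw [hmon]
    simp
    rfl
  · intro τ _ hτ
    have hne : (Finsupp.equivFunOnFinite.symm fun i => ((τ.symm i : Fin k) : ℕ)) ≠
        Finsupp.equivFunOnFinite.symm fun i : Fin k => (i : ℕ) := by
      intro h
      apply hτ
      ext i
      have := DFunLike.congr_fun h (τ i)
      simpa [eq_comm] using this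
    rw [hmon, Units.smul_def, MvPolynomial.coeff_smul, MvPolynomial.coeff_monomial, if_neg hne,
      smul_zero]
  · simp

lemma coeff_prod_linear_forms {d k : ℕ} (hkd : k ≤ d) :
    MvPolynomial.coeff (Finsupp.equivFunOnFinite.symm fun _ : Fin k => d - 1)
      ((∏ i : Fin k, (MvPolynomial.X i : MvPolynomial (Fin k) (ZMod 2)) ^ (d - ((i : ℕ) + 1))) *
        ∏ i : Fin k, ∏ j ∈ Finset.Ioi i, (MvPolynomial.X i + MvPolynomial.X j)) = 1 := by
  have hsplit : (Finsupp.equivFunOnFinite.symm fun _ : Fin k => d - 1) =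
      (Finsupp.equivFunOnFinite.symm fun i : Fin k => d - ((i : ℕ) + 1)) +
        Finsupp.equivFunOnFinite.symm fun i : Fin k => (i : ℕ) := by
    ext i
    simp only [Finsupp.equivFunOnFinite_symm_apply_apply, Finsupp.add_apply]
    lia
  rw [prod_X_pow_eq_monomial_equivFunOnFinite, hsplit, MvPolynomial.coeff_monomial_mul, one_mul,
    coeff_prod_X_add_X]

/-- A continuous function on a closed set of tuples that changes sign with the `i`-th vector and
is unaffected by the signs of the others extends, up to a positive factor, to a function on all
tuples with the same symmetry. -/
lemma exists_equivariant_extension {k : ℕ} {E : Type*} [NormedAddCommGroup E] [NormedSpace ℝ E]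
    {V : Set (Fin k → E)} (hV : IsClosed V) (i : Fin k) (f : V → ℝ) (hf : Continuous f)
    (hVsymm : ∀ ε : Fin k → ℤˣ, ∀ v ∈ V, (fun j => ((ε j : ℤ) : ℝ) • v j) ∈ V)
    (heq : ∀ ε : Fin k → ℤˣ, ∀ v w : V, (∀ j, w.1 j = ((ε j : ℤ) : ℝ) • v.1 j) →
      f w = ((ε i : ℤ) : ℝ) * f v) :
    ∃ G : (Fin k → E) → ℝ, Continuous G ∧
      (∀ m x, G (update x m (-x m)) = if m = i then - G x else G x) ∧
      ∀ v : V, G v.1 = 0 → f v = 0 := by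
  obtain ⟨F, hF⟩ := ContinuousMap.exists_restrict_eq hV (⟨f, hf⟩ : C(V, ℝ))
  have hF' : ∀ v : V, F v.1 = f v := fun v => DFunLike.congr_fun hF v
  have hunit : ∀ u : ℤˣ, ((u : ℤ) : ℝ) * ((u : ℤ) : ℝ) = 1 := fun u => by
    rcases Int.units_eq_one_or u with rfl | rfl <;> simp
  refine ⟨fun x => ∑ ε : Fin k → ℤˣ, ((ε i : ℤ) : ℝ) * F fun j => ((ε j : ℤ) : ℝ) • x j,
    by fun_prop, fun m x => ?_, fun v hv => ?_⟩
  · set η : Fin k → ℤˣ := update 1 m (-1) with hη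
    have hupd : ∀ j, update x m (-x m) j = ((η j : ℤ) : ℝ) • x j := by
      intro j
      by_cases hj : j = m
      · subst hj; simp [hη]
      · simp [hη, hj]
    have hηi : ∀ y : ℝ, (if m = i then -y else y) = ((η i : ℤ) : ℝ) * y := by
      intro y
      by_cases hi : m = i
      · subst hi; simp [hη]
      · simp [hη, hi, Ne.symm hi]
    rw [hηi]
    beta_reduce
    rw [← Equiv.sum_comp (Equiv.mulRight η)
      (fun ε => ((ε i : ℤ) : ℝ) * F fun j => ((ε j : ℤ) : ℝ) • x j), Finset.mul_sum]
    refine Finset.sum_congr rfl fun ε _ => ?_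
    simp only [hupd, smul_smul, Equiv.coe_mulRight, Pi.mul_apply, Units.val_mul, Int.cast_mul]
    linear_combination
      (-((ε i : ℤ) : ℝ) * F fun j => (((ε j : ℤ) : ℝ) * ((η j : ℤ) : ℝ)) • x j) * hunit (η i)
  · have hterm : ∀ ε : Fin k → ℤˣ,
        ((ε i : ℤ) : ℝ) * F (fun j => ((ε j : ℤ) : ℝ) • v.1 j) = f v := by
      intro ε
      rw [hF' ⟨_, hVsymm ε v.1 v.2⟩, heq ε v _ fun j => rfl, ← mul_assoc, hunit, one_mul]
    simp only [hterm, Finset.sum_const, nsmul_eq_mul] at hv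
    rcases mul_eq_zero.1 hv with h | h
    · simp at h
    · exact h

lemma isClosed_orthonormal (k : ℕ) (E : Type*) [NormedAddCommGroup E] [InnerProductSpace ℝ E] :
    IsClosed {v : Fin k → E | Orthonormal ℝ v} := by
  simp only [orthonormal_iff_ite, Set.ofPred_forall]
  refine isClosed_iInter fun i => isClosed_iInter fun j => isClosed_eq ?_ continuous_const
  exact (continuous_apply i).inner (continuous_apply j)

end Stiefel

/-- **Borsuk–Ulam for Stiefel manifolds** (Chan, Chen, Frick, Hull).
Let `V_k(ℝ^d)` be the Stiefel manifold of orthonormal `k`-frames in `ℝ^d`, realized as the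
subtype of `k`-tuples of vectors of `ℝ^d` that are orthonormal.  If
`f = (f₁, …, f_k) : V_k(ℝ^d) → ℝ^{d-1} × ⋯ × ℝ^{d-k}` is continuous and
`(ℤ₂)^k`-equivariant (flipping the sign of the `i`-th frame vector flips the sign of the
`i`-th block of the output), then `f` has a zero. -/
theorem borsuk_ulam_stiefel (d k : ℕ) (hk : 1 ≤ k) (hkd : k ≤ d)
    (f : {v : Fin k → EuclideanSpace ℝ (Fin d) // Orthonormal ℝ v} →
      ∀ i : Fin k, EuclideanSpace ℝ (Fin (d - ((i : ℕ) + 1))))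
    (hf : Continuous f)
    (heq : ∀ ε : Fin k → ℝ, (∀ j, ε j = 1 ∨ ε j = -1) →
      ∀ v w : {v : Fin k → EuclideanSpace ℝ (Fin d) // Orthonormal ℝ v},
        (∀ j, (w : Fin k → EuclideanSpace ℝ (Fin d)) j
            = ε j • (v : Fin k → EuclideanSpace ℝ (Fin d)) j) →
        ∀ i, f w i = ε i • f v i) :
    ∃ v, ∀ i, f v i = 0 := by
  have hsign : ∀ (ε : Fin k → ℤˣ) (j : Fin k),
      (((ε j : ℤˣ) : ℤ) : ℝ) = 1 ∨ (((ε j : ℤˣ) : ℤ) : ℝ) = -1 := fun ε j => by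
    rcases Int.units_eq_one_or (ε j) with h | h <;> simp [h]
  have hVsymm : ∀ ε : Fin k → ℤˣ, ∀ v ∈ {v : Fin k → EuclideanSpace ℝ (Fin d) | Orthonormal ℝ v},
      (fun j => ((ε j : ℤ) : ℝ) • v j) ∈
        {v : Fin k → EuclideanSpace ℝ (Fin d) | Orthonormal ℝ v} := by
    intro ε v hv
    refine ⟨fun j => ?_, fun a b hab => ?_⟩
    · rw [norm_smul, hv.1 j, mul_one]
      rcases hsign ε j with h | h <;> rw [h] <;> simp
    · change inner ℝ (((ε a : ℤ) : ℝ) • v a) (((ε b : ℤ) : ℝ) • v b) = 0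
      rw [real_inner_smul_left, real_inner_smul_right, hv.2 hab, mul_zero, mul_zero]
  have hext := fun y : (i : Fin k) × Fin (d - ((i : ℕ) + 1)) =>
    exists_equivariant_extension (isClosed_orthonormal k (EuclideanSpace ℝ (Fin d))) y.1
      (fun v => f v y.1 y.2) (by fun_prop) hVsymm (fun ε v w hw => by
        rw [heq (fun j => ((ε j : ℤ) : ℝ)) (hsign ε) v w hw]
        rfl)
  choose G hGc hGodd hGzero using hext
  let J := ((i : Fin k) × Fin (d - ((i : ℕ) + 1))) ⊕ ((i : Fin k) × Finset.Ioi i)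
  let χ : J → Fin k → ZMod 2 := Sum.elim (fun y => Pi.single y.1 1)
    fun y => Pi.single y.1 1 + Pi.single y.2.1 1
  let g : J → (Fin k → EuclideanSpace ℝ (Fin d)) → ℝ := Sum.elim G
    fun y x => inner ℝ (x y.1) (x y.2.1)
  have hlin : ∀ i : Fin k, (∑ m, MvPolynomial.C ((Pi.single i 1 : Fin k → ZMod 2) m) *
      MvPolynomial.X m) = (MvPolynomial.X i : MvPolynomial (Fin k) (ZMod 2)) := by
    intro i
    rw [Finset.sum_eq_single i] <;> simp +contextual
  obtain ⟨x, hx1, hx0⟩ := exists_common_zero_of_coeff_ne_zero (by lia : 0 < d) χ g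
    (by
      rintro (y | y)
      · exact hGc y
      · exact (continuous_apply _).inner (continuous_apply _))
    (by
      rintro (y | ⟨i, j, hj⟩) m x
      · change G y _ = if (Pi.single y.1 1 : Fin k → ZMod 2) m = 0 then G y x else - G y x
        rw [hGodd y m x]
        by_cases h : m = y.1 <;> simp [h]
      · have hij : i ≠ j := (Finset.mem_Ioi.1 hj).ne
        change inner ℝ (update x m (-x m) i) (update x m (-x m) j) =
          if (Pi.single i 1 + Pi.single j 1 : Fin k → ZMod 2) m = 0 then inner ℝ (x i) (x j)
          else - inner ℝ (x i) (x j)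
        by_cases hi : m = i
        · subst hi
          simp [hij, hij.symm]
        · by_cases hj : m = j
          · subst hj
            simp [hij, hi]
          · simp [hi, hj, Ne.symm hi, Ne.symm hj])
    (by
      have hprod : (∏ y : J, ∑ m, MvPolynomial.C (χ y m) * MvPolynomial.X m) =
          (∏ i : Fin k,
            (MvPolynomial.X i : MvPolynomial (Fin k) (ZMod 2)) ^ (d - ((i : ℕ) + 1))) *
          ∏ i : Fin k, ∏ j ∈ Finset.Ioi i, (MvPolynomial.X i + MvPolynomial.X j) := by
        rw [Fintype.prod_sum_type, Fintype.prod_sigma, Fintype.prod_sigma]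
        congr 1
        · refine Finset.prod_congr rfl fun i _ => ?_
          simp only [χ, Sum.elim_inl, hlin, Finset.prod_const, Finset.card_univ, Fintype.card_fin]
        · refine Finset.prod_congr rfl fun i _ => ?_
          simp only [χ, Sum.elim_inr, Pi.add_apply, map_add, add_mul, Finset.sum_add_distrib, hlin]
          exact Finset.prod_coe_sort (Finset.Ioi i)
            fun j => (MvPolynomial.X i + MvPolynomial.X j : MvPolynomial (Fin k) (ZMod 2))
      rw [hprod, coeff_prod_linear_forms hkd]
      exact one_ne_zero)
  have horth : ∀ i j : Fin k, i < j → inner ℝ (x i) (x j) = 0 := fun i j hij =>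
    hx0 (Sum.inr ⟨i, j, Finset.mem_Ioi.2 hij⟩)
  refine ⟨⟨x, hx1, fun i j hij => ?_⟩, fun i => ?_⟩
  · rcases lt_or_gt_of_ne hij with h | h
    · exact horth i j h
    · rw [real_inner_comm]
      exact horth j i h
  · ext l
    exact hGzero ⟨i, l⟩ _ (hx0 (Sum.inl ⟨i, l⟩))
end

section
/- Let 1 ≤ k ≤ d be integers and let (π_{d-1}, …, π_{k-1}) be a permutation of (d−1, …, k−1). For each i = k−1, …, d−1, let ν_{i,0}, ν_{i,1}, …, ν_{i,π_i} be finite measures on ℝ^d, each absolutely continuous with respect to the Lebesgue measure. Then there exist affine subspaces S_{k-1} ⊂ S_k ⊂ ⋯ ⊂ S_{d-1} ⊂ S_d = ℝ^d with dim S_i = i for each i, such that for every i = k−1, …, d−1 and every j = 0, …, π_i, the subspace S_i bisects the pushforward of ν_{i,j} under the orthogonal projection onto S_{i+1}: the two closed half-spaces of S_{i+1} bounded by S_i have equal measure for the projected measure. -/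
open MeasureTheory Module
open scoped RealInnerProductSpace

namespace BorsukUlam

/-- Mod 2 chains on ordered simplices, a simplex being the list of its vertices. -/
abbrev Chain (E : Type*) := List E →₀ ZMod 2

section Chains

variable {E : Type*}

/-- The join of a vertex with a chain. -/
noncomputable def cone (b : E) : Chain E →ₗ[ZMod 2] Chain E :=
  Finsupp.lmapDomain _ _ (List.cons b)

/-- The (augmented) simplicial boundary of a simplex. -/
noncomputable def face : List E → Chain E
  | [] => 0
  | x :: l => Finsupp.single l 1 + cone x (face l)

/-- The (augmented) simplicial boundary of a chain. -/
noncomputable def boundary : Chain E →ₗ[ZMod 2] Chain E :=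
  Finsupp.linearCombination _ face

@[simp] lemma cone_single (b : E) (l : List E) (r : ZMod 2) :
    cone b (Finsupp.single l r) = Finsupp.single (b :: l) r := by
  simp [cone]

@[simp] lemma boundary_single (l : List E) : boundary (Finsupp.single l 1) = face l := by
  simp [boundary]

lemma boundary_cone (b : E) (c : Chain E) :
    boundary (cone b c) = c + cone b (boundary c) := by
  have : boundary ∘ₗ cone b = LinearMap.id + cone b ∘ₗ boundary := by
    ext l : 2
    simp [face]
  exact LinearMap.congr_fun this c

lemma boundary_face (l : List E) : boundary (face l) = 0 := by
  induction l with
  | nil => simp [face]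
  | cons x l ih =>
    simp [face, boundary_cone, ih, ZModModule.add_self]

lemma linearMap_mem_supported (f : Chain E →ₗ[ZMod 2] Chain E) {s t : Set (List E)}
    (h : ∀ l ∈ s, f (Finsupp.single l 1) ∈ Finsupp.supported (ZMod 2) (ZMod 2) t)
    {c : Chain E} (hc : c ∈ Finsupp.supported (ZMod 2) (ZMod 2) s) :
    f c ∈ Finsupp.supported (ZMod 2) (ZMod 2) t := by
  rw [Finsupp.supported_eq_span_single] at hc
  induction hc using Submodule.span_induction with
  | mem x hx => obtain ⟨l, hl, rfl⟩ := hx; exact h l hl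
  | zero => simp
  | add x y _ _ hx hy => rw [map_add]; exact add_mem hx hy
  | smul a x _ hx => rw [map_smul]; exact Submodule.smul_mem _ _ hx

lemma linearMap_eq_of_supported {M : Type*} [AddCommGroup M] [Module (ZMod 2) M]
    (f g : Chain E →ₗ[ZMod 2] M) {s : Set (List E)}
    (h : ∀ l ∈ s, f (Finsupp.single l 1) = g (Finsupp.single l 1))
    {c : Chain E} (hc : c ∈ Finsupp.supported (ZMod 2) (ZMod 2) s) :
    f c = g c := by
  rw [Finsupp.supported_eq_span_single] at hc
  induction hc using Submodule.span_induction with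
  | mem x hx => obtain ⟨l, hl, rfl⟩ := hx; exact h l hl
  | zero => simp
  | add x y _ _ hx hy => rw [map_add, map_add, hx, hy]
  | smul a x _ hx => rw [map_smul, map_smul, hx]

lemma face_mem_supported (n : ℕ) (l : List E) (hl : l.length = n + 1) :
    face l ∈ Finsupp.supported (ZMod 2) (ZMod 2) {l' | l'.length = n ∧ l' ⊆ l} := by
  induction l generalizing n with
  | nil => simp at hl
  | cons x l ih =>
    refine add_mem (Finsupp.single_mem_supported _ _ ⟨by simpa using hl, by simp⟩) ?_
    obtain _ | n := n
    · obtain rfl : l = [] := by simpa using hl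
      simp [face]
    · refine linearMap_mem_supported _ ?_ (ih n (by simpa using hl))
      rintro l' ⟨h1, h2⟩
      rw [cone_single]
      exact Finsupp.single_mem_supported _ _
        ⟨by simp [h1], List.cons_subset_cons _ h2⟩

end Chains

section Cochains

variable {E : Type*} (s : ℕ → E → ZMod 2)

/-- The cup product of the coboundaries of the `0`-cochains `s i`. -/
def cup : List E → ZMod 2
  | [] => 0
  | [_] => 1
  | x :: y :: l => (s l.length x + s l.length y) * cup (y :: l)

/-- A cochain `φ` with `φ + φ ∘ (antipode) = cup` whose coboundary is the next `cup`. -/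
def halfCup : List E → ZMod 2
  | [] => 0
  | x :: l => s l.length x * cup s (x :: l)

/-- Evaluation of a cochain on a chain. -/
noncomputable def eval (φ : List E → ZMod 2) : Chain E →ₗ[ZMod 2] ZMod 2 :=
  Finsupp.linearCombination _ φ

@[simp] lemma eval_single (φ : List E → ZMod 2) (l : List E) :
    eval φ (Finsupp.single l 1) = φ l := by
  simp [eval]

lemma eval_cone_cone (x y : E) (n : ℕ) {c : Chain E}
    (hc : c ∈ Finsupp.supported (ZMod 2) (ZMod 2) {l | l.length = n}) :
    eval (cup s) (cone x (cone y c)) = (s n x + s n y) * eval (cup s) (cone y c) := by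
  refine linearMap_eq_of_supported (eval (cup s) ∘ₗ cone x ∘ₗ cone y)
    ((s n x + s n y) • (eval (cup s) ∘ₗ cone y)) ?_ hc
  rintro l rfl
  simp [cup]

lemma eval_cup_face (l : List E) (hl : 2 ≤ l.length) : eval (cup s) (face l) = 0 := by
  induction l with
  | nil => simp at hl
  | cons x l ih =>
    obtain _ | ⟨y, l⟩ := l
    · simp at hl
    obtain _ | ⟨z, l⟩ := l
    · simp [face, cup]
      decide
    have h := ih (by simp)
    have e : eval (cup s) (cone x (cone y (face (z :: l)))) = _ :=
      eval_cone_cone s x y l.length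
        (Finsupp.supported_mono (fun l' h => h.1) (face_mem_supported l.length (z :: l) (by simp)))
    have h1 : face (y :: z :: l) = Finsupp.single (z :: l) 1 + cone y (face (z :: l)) := rfl
    have h2 : face (x :: y :: z :: l)
      = Finsupp.single (y :: z :: l) 1 + cone x (face (y :: z :: l)) := rfl
    rw [h2, h1]
    rw [h1, map_add, eval_single] at h
    simp only [map_add, e, cone_single, eval_single, cup]
    linear_combination (s l.length x + s l.length y) * h +
      s l.length z * cup s (z :: l) * (CharTwo.two_eq_zero : (2 : ZMod 2) = 0)

lemma eval_halfCup_face (l : List E) (hl : 2 ≤ l.length) :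
    eval (halfCup s) (face l) = cup s l := by
  obtain _ | ⟨x, _ | ⟨y, l⟩⟩ := l
  · simp at hl
  · simp at hl
  have h := eval_cup_face s (x :: y :: l) hl
  have key : eval (halfCup s) (cone x (face (y :: l))) =
      s l.length x * eval (cup s) (cone x (face (y :: l))) := by
    refine linearMap_eq_of_supported (eval (halfCup s) ∘ₗ cone x)
      (s l.length x • (eval (cup s) ∘ₗ cone x)) ?_
      (Finsupp.supported_mono (fun l' h => h.1) (face_mem_supported l.length (y :: l) (by simp)))
    rintro l' hl'
    have : l'.length = l.length := hl'
    simp [halfCup, this]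
  have h2 : face (x :: y :: l)
      = Finsupp.single (y :: l) 1 + cone x (face (y :: l)) := rfl
  rw [h2, map_add, eval_single] at h ⊢
  rw [key]
  simp only [halfCup, cup]
  linear_combination (s l.length x) * h -
      s l.length x * cup s (y :: l) * (CharTwo.two_eq_zero : (2 : ZMod 2) = 0)

lemma eval_halfCup_boundary (n : ℕ) {c : Chain E}
    (hc : c ∈ Finsupp.supported (ZMod 2) (ZMod 2) {l | l.length = n + 2}) :
    eval (halfCup s) (boundary c) = eval (cup s) c := by
  refine linearMap_eq_of_supported (eval (halfCup s) ∘ₗ boundary) (eval (cup s)) ?_ hc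
  intro l hl
  have : l.length = n + 2 := hl
  simp [eval_halfCup_face s l (by omega)]

/-- The cup product vanishes on simplices on which one of the `0`-cochains is constant. -/
lemma cup_eq_zero (l : List E) (i : ℕ) (hi : i + 1 < l.length)
    (h : ∀ x ∈ l, ∀ y ∈ l, s i x = s i y) : cup s l = 0 := by
  induction l with
  | nil => simp at hi
  | cons x l ih =>
    obtain _ | ⟨y, l⟩ := l
    · simp at hi
    rw [cup]
    by_cases hil : i = l.length
    · subst hil
      rw [h x (by simp) y (by simp), CharTwo.add_self_eq_zero, zero_mul]
    · rw [ih (by simp at hi ⊢; omega)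
        (fun a ha b hb => h a (List.mem_cons_of_mem _ ha) b (List.mem_cons_of_mem _ hb)),
        mul_zero]

end Cochains

section Antipode

variable {E : Type*} [AddCommGroup E]

/-- The action of the antipodal map on chains. -/
noncomputable def antipode : Chain E →ₗ[ZMod 2] Chain E :=
  Finsupp.lmapDomain _ _ (List.map Neg.neg)

@[simp] lemma antipode_single (l : List E) (r : ZMod 2) :
    antipode (Finsupp.single l r) = Finsupp.single (l.map Neg.neg) r := by
  simp [antipode]

lemma antipode_cone (b : E) (c : Chain E) :
    antipode (cone b c) = cone (-b) (antipode c) := by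
  have : antipode ∘ₗ cone b = cone (-b) ∘ₗ antipode := by
    ext l : 2
    simp
  exact LinearMap.congr_fun this c

lemma antipode_face (l : List E) : face (l.map Neg.neg) = antipode (face l) := by
  induction l with
  | nil => simp [face]
  | cons x l ih => simp [face, antipode_cone, ih]

lemma cup_antipode (s : ℕ → E → ZMod 2) (l : List E)
    (hs : ∀ i, ∀ x ∈ l, s i (-x) = s i x + 1) : cup s (l.map Neg.neg) = cup s l := by
  induction l with
  | nil => simp
  | cons x l ih =>
    obtain _ | ⟨y, l⟩ := l
    · simp [cup]
    have := ih (fun i a ha => hs i a (List.mem_cons_of_mem _ ha))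
    simp only [List.map_cons] at this
    simp only [List.map_cons, cup, this, List.length_map]
    rw [hs _ x (by simp), hs _ y (by simp)]
    linear_combination cup s (y :: l) * (CharTwo.two_eq_zero : (2 : ZMod 2) = 0)

lemma eval_halfCup_add_antipode (s : ℕ → E → ZMod 2) {c : Chain E}
    (hc : c ∈ Finsupp.supported (ZMod 2) (ZMod 2)
      {l | ∀ i, ∀ x ∈ l, s i (-x) = s i x + 1}) :
    eval (halfCup s) (c + antipode c) = eval (cup s) c := by
  rw [map_add]
  refine linearMap_eq_of_supported (eval (halfCup s) + eval (halfCup s) ∘ₗ antipode)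
    (eval (cup s)) ?_ hc
  intro l hl
  have h1 := cup_antipode s l hl
  obtain _ | ⟨x, l⟩ := l
  · simp [halfCup, cup]
  simp only [List.map_cons] at h1
  simp only [LinearMap.add_apply, LinearMap.comp_apply, antipode_single, eval_single,
    List.map_cons, halfCup, List.length_map, h1, hl _ x (by simp)]
  linear_combination (s l.length x * cup s (x :: l)) *
    (CharTwo.two_eq_zero : (2 : ZMod 2) = 0)

end Antipode

section Subdivision

variable {E : Type*} [AddCommGroup E] [Module ℝ E]

/-- The barycenter of a simplex. -/
noncomputable def mean (l : List E) : E := (l.length : ℝ)⁻¹ • l.sum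

lemma mean_map_neg (l : List E) : mean (l.map Neg.neg) = -mean l := by
  have : (l.map Neg.neg).sum = -l.sum := by
    induction l with
    | nil => simp
    | cons x l ih => rw [List.map_cons, List.sum_cons, List.sum_cons, ih, neg_add]
  simp [mean, this]

lemma mean_mem {C : Set E} (hC : Convex ℝ C) {l : List E} (hl : l ≠ [])
    (h : ∀ x ∈ l, x ∈ C) : mean l ∈ C := by
  have h0 : (l.length : ℝ) ≠ 0 := by simpa using hl
  have : mean l = ∑ i : Fin l.length, (l.length : ℝ)⁻¹ • l[i] := by
    rw [← Finset.smul_sum, mean]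
    exact congrArg _ (Fin.sum_univ_getElem l).symm
  rw [this]
  refine hC.sum_mem (fun _ _ => by positivity) ?_ (fun i _ => h _ (List.getElem_mem _))
  simp [h0]

/-- Barycentric subdivision of a simplex with `n` vertices. -/
noncomputable def subdivSimplex : ℕ → List E → Chain E
  | 0, l => Finsupp.single l 1
  | n + 1, l => cone (mean l) (Finsupp.linearCombination _ (subdivSimplex n) (face l))

/-- Barycentric subdivision of a chain of simplices with `n` vertices. -/
noncomputable def subdiv (n : ℕ) : Chain E →ₗ[ZMod 2] Chain E :=
  Finsupp.linearCombination _ (subdivSimplex n)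

lemma subdiv_zero (c : Chain E) : subdiv 0 c = c := by
  have : subdiv (E := E) 0 = LinearMap.id := by
    ext l : 2
    simp [subdiv, subdivSimplex]
  exact LinearMap.congr_fun this c

lemma subdiv_succ_single (n : ℕ) (l : List E) :
    subdiv (n + 1) (Finsupp.single l 1) = cone (mean l) (subdiv n (face l)) := by
  simp [subdiv, subdivSimplex]

lemma boundary_subdiv (n : ℕ) (c : Chain E) :
    boundary (subdiv (n + 1) c) = subdiv n (boundary c) := by
  induction n generalizing c with
  | zero =>
    have : boundary ∘ₗ subdiv (E := E) 1 = boundary := by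
      ext l : 2
      simp [subdiv_succ_single, boundary_cone, subdiv_zero, boundary_face]
    rw [subdiv_zero]
    exact LinearMap.congr_fun this c
  | succ n ih =>
    have : boundary ∘ₗ subdiv (E := E) (n + 2) = subdiv (n + 1) ∘ₗ boundary := by
      ext l : 2
      simp [subdiv_succ_single, boundary_cone, ih, boundary_face]
    exact LinearMap.congr_fun this c

lemma subdiv_antipode (n : ℕ) (c : Chain E) :
    subdiv n (antipode c) = antipode (subdiv n c) := by
  induction n generalizing c with
  | zero => simp [subdiv_zero]
  | succ n ih =>
    have : subdiv (E := E) (n + 1) ∘ₗ antipode = antipode ∘ₗ subdiv (n + 1) := by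
      ext l : 2
      simp [subdiv_succ_single, antipode_cone, antipode_face, mean_map_neg, ih]
    exact LinearMap.congr_fun this c

end Subdivision

section Mesh

variable {E : Type*} [NormedAddCommGroup E] [NormedSpace ℝ E]

/-- The simplices with `n` vertices in `C` and with edges of length at most `D`. -/
def simplices (n : ℕ) (C : Set E) (D : ℝ) : Set (List E) :=
  {l | l.length = n ∧ (∀ x ∈ l, x ∈ C) ∧ ∀ x ∈ l, ∀ y ∈ l, dist x y ≤ D}

lemma norm_sum_sub_le (l : List E) (x : E) (D : ℝ) (h : ∀ y ∈ l, dist y x ≤ D) :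
    ‖l.sum - (l.length : ℝ) • x‖ ≤ l.length * D := by
  induction l with
  | nil => simp
  | cons y l ih =>
    have h1 := ih (fun z hz => h z (List.mem_cons_of_mem _ hz))
    have h2 := h y (by simp)
    rw [dist_eq_norm] at h2
    have : (y :: l).sum - ((y :: l).length : ℝ) • x
        = (y - x) + (l.sum - (l.length : ℝ) • x) := by
      simp [add_smul]; abel
    rw [this]
    refine (norm_add_le _ _).trans ?_
    push_cast [List.length_cons]
    linarith

lemma dist_mean_le {n : ℕ} {l : List E} (hl : l.length = n + 1) {x : E} (hx : x ∈ l) {D : ℝ}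
    (h : ∀ y ∈ l, dist y x ≤ D) : dist x (mean l) ≤ n / (n + 1) * D := by
  obtain ⟨l₁, l₂, rfl⟩ := List.append_of_mem hx
  have hn : (l₁ ++ l₂).length = n := by simp at hl ⊢; omega
  have h1 := norm_sum_sub_le (l₁ ++ l₂) x D (fun y hy => h y (by
    rcases List.mem_append.1 hy with h | h <;> simp [h]))
  rw [hn] at h1
  have hs : (l₁ ++ x :: l₂).sum = x + (l₁ ++ l₂).sum := by simp; abel
  have h0 : (n : ℝ) + 1 ≠ 0 := by positivity
  have h2 : mean (l₁ ++ x :: l₂) - x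
      = ((n : ℝ) + 1)⁻¹ • ((l₁ ++ l₂).sum - (n : ℝ) • x) := by
    rw [mean, hl, hs]
    push_cast
    rw [← sub_eq_zero, smul_add, smul_sub, smul_smul]
    have : x = (((n : ℝ) + 1)⁻¹ + ((n : ℝ) + 1)⁻¹ * n) • x := by
      rw [show ((n : ℝ) + 1)⁻¹ + ((n : ℝ) + 1)⁻¹ * n = 1 by field_simp; ring, one_smul]
    nth_rw 2 [this]
    rw [add_smul]
    abel
  rw [dist_comm, dist_eq_norm, h2, norm_smul, norm_inv, Real.norm_of_nonneg (by positivity)]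
  calc ((n : ℝ) + 1)⁻¹ * _ ≤ ((n : ℝ) + 1)⁻¹ * (n * D) := by gcongr
    _ = _ := by ring

/-- Barycentric subdivision contracts the mesh of simplices with at most `M + 1` vertices. -/
lemma subdiv_mem_supported (M : ℕ) {D : ℝ} (hD : 0 ≤ D) (n : ℕ) (hn : n ≤ M + 1) {C : Set E}
    (hC : Convex ℝ C) {c : Chain E}
    (hc : c ∈ Finsupp.supported (ZMod 2) (ZMod 2) (simplices n C D)) :
    subdiv n c ∈ Finsupp.supported (ZMod 2) (ZMod 2) (simplices n C (M / (M + 1) * D)) := by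
  induction n generalizing C c with
  | zero =>
    rw [subdiv_zero]
    refine Finsupp.supported_mono ?_ hc
    rintro l ⟨h1, -, -⟩
    obtain rfl := List.length_eq_zero_iff.1 h1
    simp [simplices]
  | succ n ih =>
    refine linearMap_mem_supported _ ?_ hc
    rintro l ⟨h1, h2, h3⟩
    rw [subdiv_succ_single]
    have hr : (n : ℝ) / (n + 1) * D ≤ M / (M + 1) * D := by
      have : (n : ℝ) ≤ M := by exact_mod_cast Nat.le_of_succ_le_succ hn
      refine mul_le_mul_of_nonneg_right ?_ hD
      rw [div_le_div_iff₀ (by positivity) (by positivity)]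
      linarith
    have hb : mean l ∈ C := mean_mem hC (by rintro rfl; simp at h1) h2
    have hf : face l ∈ Finsupp.supported (ZMod 2) (ZMod 2)
        (simplices n (C ∩ Metric.closedBall (mean l) (M / (M + 1) * D)) D) := by
      refine Finsupp.supported_mono ?_ (face_mem_supported n l h1)
      rintro l' ⟨h4, h5⟩
      exact ⟨h4, fun x hx => ⟨h2 x (h5 hx), (dist_mean_le h1 (h5 hx)
        (fun y hy => h3 y hy x (h5 hx))).trans hr⟩, fun x hx y hy => h3 x (h5 hx) y (h5 hy)⟩
    refine linearMap_mem_supported _ ?_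
      (ih (by omega) (hC.inter (convex_closedBall _ _)) hf)
    rintro l' ⟨h4, h5, h6⟩
    rw [cone_single]
    refine Finsupp.single_mem_supported _ _ ⟨by simp [h4], ?_, ?_⟩
    · intro x hx
      rcases List.mem_cons.1 hx with rfl | hx
      · exact hb
      · exact (h5 x hx).1
    · intro x hx y hy
      rcases List.mem_cons.1 hx with rfl | hx <;> rcases List.mem_cons.1 hy with rfl | hy
      · rw [dist_self]; positivity
      · rw [dist_comm]; exact (h5 y hy).2
      · exact (h5 x hx).2
      · exact h6 x hx y hy

/-- A tower of chains `h i`, each consisting of simplices contained in members of `𝒞` and of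
mesh at most `D`, that behave like the hemispheres of the spheres `S ^ i`, `i ≤ m`. -/
structure IsHemisphereTower (m : ℕ) (𝒞 : Set (Set E)) (D : ℝ) (h : ℕ → Chain E) : Prop where
  zero : ∃ e, h 0 = Finsupp.single [e] 1
  mem_supported : ∀ i ≤ m,
    h i ∈ Finsupp.supported (ZMod 2) (ZMod 2) (⋃ C ∈ 𝒞, simplices (i + 1) C D)
  boundary_succ : ∀ i < m, boundary (h (i + 1)) = h i + antipode (h i)

lemma IsHemisphereTower.subdiv {m : ℕ} {𝒞 : Set (Set E)} (h𝒞 : ∀ C ∈ 𝒞, Convex ℝ C) {D : ℝ}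
    (hD : 0 ≤ D) {h : ℕ → Chain E} (hh : IsHemisphereTower m 𝒞 D h) :
    IsHemisphereTower m 𝒞 (m / (m + 1) * D) (fun i => subdiv (i + 1) (h i)) where
  zero := by
    obtain ⟨e, he⟩ := hh.zero
    refine ⟨e, ?_⟩
    simp [he, subdiv_succ_single, face, subdiv_zero, mean]
  mem_supported i hi := by
    refine linearMap_mem_supported _ ?_ (hh.mem_supported i hi)
    intro l hl
    simp only [Set.mem_iUnion] at hl
    obtain ⟨C, hC, hl⟩ := hl
    refine Finsupp.supported_mono ?_ (subdiv_mem_supported m hD (i + 1) (by omega) (h𝒞 C hC)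
      (Finsupp.single_mem_supported _ _ hl))
    exact Set.subset_biUnion_of_mem (u := fun C => simplices (i + 1) C (m / (m + 1) * D)) hC
  boundary_succ i hi := by
    rw [boundary_subdiv, hh.boundary_succ i hi, map_add, subdiv_antipode]

lemma IsHemisphereTower.exists_mesh_lt {m : ℕ} {𝒞 : Set (Set E)} (h𝒞 : ∀ C ∈ 𝒞, Convex ℝ C)
    {D : ℝ} (hD : 0 ≤ D) {h : ℕ → Chain E} (hh : IsHemisphereTower m 𝒞 D h) {δ : ℝ}
    (hδ : 0 < δ) : ∃ D' < δ, ∃ h', IsHemisphereTower m 𝒞 D' h' := by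
  have key : ∀ N : ℕ, ∃ h', IsHemisphereTower m 𝒞 ((m / (m + 1) : ℝ) ^ N * D) h' := by
    intro N
    induction N with
    | zero => exact ⟨h, by simpa using hh⟩
    | succ N ih =>
      obtain ⟨h', hh'⟩ := ih
      refine ⟨fun i => BorsukUlam.subdiv (i + 1) (h' i), ?_⟩
      rw [pow_succ', mul_assoc]
      exact hh'.subdiv h𝒞 (by positivity)
  have hr : (m / (m + 1) : ℝ) < 1 := by
    rw [div_lt_one (by positivity)]; linarith
  have ht := (tendsto_pow_atTop_nhds_zero_of_lt_one (by positivity) hr).mul_const D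
  rw [zero_mul] at ht
  obtain ⟨N, hN⟩ := (ht.eventually (gt_mem_nhds hδ)).exists
  exact ⟨_, hN, key N⟩

omit [NormedSpace ℝ E] in
/-- Cup products of odd `0`-cochains evaluate to `1` on the top hemisphere. -/
lemma IsHemisphereTower.eval_cup {m : ℕ} {𝒞 : Set (Set E)} {D : ℝ} {h : ℕ → Chain E}
    (hh : IsHemisphereTower m 𝒞 D h) (s : ℕ → E → ZMod 2)
    (hs : ∀ C ∈ 𝒞, ∀ x ∈ C, ∀ i, s i (-x) = s i x + 1) (i : ℕ) (hi : i ≤ m) :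
    eval (cup s) (h i) = 1 := by
  induction i with
  | zero =>
    obtain ⟨e, he⟩ := hh.zero
    simp [he, cup]
  | succ i ih =>
    rw [← eval_halfCup_boundary s i, hh.boundary_succ i hi, eval_halfCup_add_antipode,
      ih (by omega)]
    · refine Finsupp.supported_mono ?_ (hh.mem_supported i (by omega))
      intro l hl j x hx
      simp only [Set.mem_iUnion] at hl
      obtain ⟨C, hC, hl⟩ := hl
      exact hs C hC x (hl.2.1 x hx) j
    · refine Finsupp.supported_mono ?_ (hh.mem_supported (i + 1) hi)
      intro l hl
      simp only [Set.mem_iUnion] at hl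
      obtain ⟨C, hC, hl⟩ := hl
      exact hl.1

end Mesh

section CrossPolytope

variable {m : ℕ}

/-- A facet of the cross-polytope. -/
def facet (σ : Fin (m + 1) → ℝ) : Set (Fin (m + 1) → ℝ) :=
  {x | (∀ j, 0 ≤ σ j * x j) ∧ ∑ j, σ j * x j = 1}

lemma convex_facet (σ : Fin (m + 1) → ℝ) : Convex ℝ (facet σ) := by
  rintro x ⟨hx, hx'⟩ y ⟨hy, hy'⟩ a b ha hb hab
  refine ⟨fun j => ?_, ?_⟩
  · have := add_nonneg (mul_nonneg ha (hx j)) (mul_nonneg hb (hy j))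
    simp only [Pi.add_apply, Pi.smul_apply, smul_eq_mul]
    linarith
  · calc ∑ j, σ j * (a • x + b • y) j = a * ∑ j, σ j * x j + b * ∑ j, σ j * y j := by
          rw [Finset.mul_sum, Finset.mul_sum, ← Finset.sum_add_distrib]
          exact Finset.sum_congr rfl fun j _ => by simp; ring
      _ = 1 := by rw [hx', hy', mul_one, mul_one, hab]

/-- The facets of the cross-polytope. -/
def facets (m : ℕ) : Set (Set (Fin (m + 1) → ℝ)) := facet '' {σ | ∀ j, |σ j| = 1}

lemma sum_abs_of_mem_facet {σ x : Fin (m + 1) → ℝ} (hσ : ∀ j, |σ j| = 1) (hx : x ∈ facet σ) :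
    ∑ j, |x j| = 1 := by
  rw [← hx.2]
  refine Finset.sum_congr rfl fun j _ => ?_
  rw [← abs_of_nonneg (hx.1 j), abs_mul, hσ, one_mul]

/-- The `i`-th vertex of the cross-polytope. -/
def vertex (m i : ℕ) : Fin (m + 1) → ℝ := fun j => if (j : ℕ) = i then 1 else 0

/-- The chain of all top simplices of the boundary of the `i`-dimensional cross-polytope. -/
noncomputable def crossPolytope (m : ℕ) : ℕ → Chain (Fin (m + 1) → ℝ)
  | 0 => Finsupp.single [] 1
  | i + 1 => cone (vertex m i) (crossPolytope m i) + cone (-vertex m i) (crossPolytope m i)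

lemma antipode_crossPolytope (i : ℕ) : antipode (crossPolytope m i) = crossPolytope m i := by
  induction i with
  | zero => simp [crossPolytope]
  | succ i ih =>
    rw [crossPolytope, map_add, antipode_cone, antipode_cone, ih, neg_neg]
    exact add_comm _ _

lemma boundary_crossPolytope (i : ℕ) : boundary (crossPolytope m i) = 0 := by
  induction i with
  | zero => simp [crossPolytope, face]
  | succ i ih =>
    rw [crossPolytope, map_add, boundary_cone, boundary_cone, ih, map_zero, map_zero, add_zero,
      ZModModule.add_self]

/-- The simplices with `i` vertices in the boundary of the `i`-dimensional cross-polytope. -/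
def crossSimplices (m i : ℕ) : Set (List (Fin (m + 1) → ℝ)) :=
  {l | l.length = i ∧ ∃ σ : Fin (m + 1) → ℝ, (∀ j, |σ j| = 1) ∧
    ∀ x ∈ l, x ∈ facet σ ∧ ∀ j : Fin (m + 1), i ≤ j → x j = 0}

lemma cone_mem_supported_crossSimplices (i : ℕ) (hi : i ≤ m) {ε : ℝ} (hε : |ε| = 1)
    {c : Chain (Fin (m + 1) → ℝ)}
    (hc : c ∈ Finsupp.supported (ZMod 2) (ZMod 2) (crossSimplices m i)) :
    cone (ε • vertex m i) c ∈
      Finsupp.supported (ZMod 2) (ZMod 2) (crossSimplices m (i + 1)) := by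
  refine linearMap_mem_supported _ ?_ hc
  rintro l ⟨h1, σ, hσ, h2⟩
  rw [cone_single]
  let k : Fin (m + 1) := ⟨i, by omega⟩
  have hεε : ε * ε = 1 := by rw [← abs_mul_abs_self, hε, one_mul]
  have hk : ∀ j : Fin (m + 1), (j : ℕ) = i ↔ j = k := fun j => by simp [k, Fin.ext_iff]
  refine Finsupp.single_mem_supported _ _
    ⟨by simp [h1], Function.update σ k ε, fun j => ?_, fun x hx => ?_⟩
  · by_cases hj : j = k
    · subst hj; simpa using hε
    · simp [hj, hσ]
  · rcases List.mem_cons.1 hx with rfl | hx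
    · have : ∀ j, Function.update σ k ε j * (ε • vertex m i) j = if j = k then 1 else 0 := by
        intro j
        by_cases hj : j = k
        · subst hj; simp [vertex, k, hεε]
        · simp [vertex, hk, hj]
      refine ⟨⟨fun j => ?_, ?_⟩, fun j hj => ?_⟩
      · rw [this]; split_ifs <;> simp
      · rw [Finset.sum_congr rfl fun j _ => this j]; simp
      · have : (j : ℕ) ≠ i := by omega
        simp [vertex, this]
    · obtain ⟨⟨h3, h4⟩, h5⟩ := h2 x hx
      have : ∀ j, Function.update σ k ε j * x j = σ j * x j := by
        intro j
        by_cases hj : j = k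
        · subst hj; simp [h5 k le_rfl]
        · simp [hj]
      refine ⟨⟨fun j => ?_, ?_⟩, fun j hj => h5 j (by omega)⟩
      · rw [this]; exact h3 j
      · rw [Finset.sum_congr rfl fun j _ => this j]; exact h4

lemma crossPolytope_mem_supported (i : ℕ) (hi : i ≤ m + 1) :
    crossPolytope m i ∈ Finsupp.supported (ZMod 2) (ZMod 2) (crossSimplices m i) := by
  induction i with
  | zero => exact Finsupp.single_mem_supported _ _ ⟨rfl, fun _ => 1, by simp, by simp⟩
  | succ i ih =>
    have h := ih (by omega)
    refine add_mem ?_ ?_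
    · simpa using cone_mem_supported_crossSimplices i (by omega) (ε := 1) (by simp) h
    · simpa using cone_mem_supported_crossSimplices i (by omega) (ε := -1) (by simp) h

lemma crossSimplices_subset (i : ℕ) :
    crossSimplices m i ⊆ ⋃ C ∈ facets m, simplices i C 2 := by
  rintro l ⟨h1, σ, hσ, h2⟩
  refine Set.mem_biUnion (Set.mem_image_of_mem facet hσ)
    ⟨h1, fun x hx => (h2 x hx).1, fun x hx y hy => ?_⟩
  have habs : ∀ z ∈ l, ∀ j, |z j| ≤ 1 := fun z hz j => by
    rw [← sum_abs_of_mem_facet hσ (h2 z hz).1]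
    exact Finset.single_le_sum (f := fun j => |z j|) (fun j _ => abs_nonneg _)
      (Finset.mem_univ j)
  rw [dist_pi_le_iff (by norm_num)]
  intro j
  rw [Real.dist_eq]
  linarith [abs_sub (x j) (y j), habs x hx j, habs y hy j]

lemma exists_isHemisphereTower (m : ℕ) :
    ∃ h, IsHemisphereTower m (facets m) 2 h := by
  refine ⟨fun i => cone (vertex m i) (crossPolytope m i), ⟨vertex m 0, ?_⟩, fun i hi => ?_,
    fun i hi => ?_⟩
  · simp [crossPolytope]
  · refine Finsupp.supported_mono (crossSimplices_subset (i + 1)) ?_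
    simpa using cone_mem_supported_crossSimplices i hi (ε := 1) (by simp)
      (crossPolytope_mem_supported i (by omega))
  · rw [boundary_cone, boundary_crossPolytope, map_zero, add_zero, antipode_cone,
      antipode_crossPolytope, crossPolytope]

end CrossPolytope

section BorsukUlamTheorem

/-- There is an odd `0`-cochain away from the origin. -/
lemma exists_odd_cochain (E : Type*) [AddCommGroup E] [IsAddTorsionFree E] :
    ∃ s : E → ZMod 2, ∀ x ≠ 0, s (-x) = s x + 1 := by
  classical
  refine ⟨fun x => if WellOrderingRel x (-x) then 1 else 0, fun x hx => ?_⟩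
  have hne : x ≠ -x := fun h => hx (self_eq_neg.1 h)
  simp only [neg_neg]
  rcases trichotomous_of WellOrderingRel x (-x) with h | h | h
  · rw [if_pos h, if_neg (asymm h)]; decide
  · exact absurd h hne
  · rw [if_pos h, if_neg (asymm h)]; decide

/-- The **Borsuk–Ulam theorem**. -/
theorem exists_eq_zero (m : ℕ) (f : (Fin (m + 1) → ℝ) → Fin m → ℝ)
    (hf : ContinuousOn f {0}ᶜ) (hodd : ∀ x, f (-x) = -f x) : ∃ x ≠ 0, f x = 0 := by
  classical
  by_contra! hne
  let K : Set (Fin (m + 1) → ℝ) := {x | ∑ j, |x j| = 1}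
  have hK0 : ∀ x ∈ K, x ≠ 0 := by
    rintro x hx rfl
    simp [K] at hx
  have hKc : IsCompact K := by
    refine Metric.isCompact_of_isClosed_isBounded
      (isClosed_eq (by fun_prop) continuous_const) ?_
    refine (Metric.isBounded_closedBall (x := 0) (r := 1)).subset fun x hx => ?_
    rw [mem_closedBall_zero_iff, pi_norm_le_iff_of_nonneg zero_le_one]
    intro j
    rw [← show ∑ j, |x j| = 1 from hx]
    exact Finset.single_le_sum (f := fun j => |x j|) (fun j _ => abs_nonneg _)
      (Finset.mem_univ j)
  have hfacet : ∀ C ∈ facets m, C ⊆ K := by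
    rintro _ ⟨σ, hσ, rfl⟩ x hx
    exact sum_abs_of_mem_facet hσ hx
  let U : Fin m × Bool → Set (Fin (m + 1) → ℝ) := fun p =>
    {0}ᶜ ∩ f ⁻¹' {y | if p.2 then 0 < y p.1 else y p.1 < 0}
  have hU : ∀ p, IsOpen (U p) := by
    rintro ⟨j, b⟩
    refine hf.isOpen_inter_preimage isOpen_compl_singleton ?_
    cases b
    · simpa using isOpen_lt (continuous_apply j) continuous_const
    · simpa using isOpen_lt continuous_const (continuous_apply j)
  have hKU : K ⊆ ⋃ p, U p := by
    intro x hx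
    obtain ⟨j, hj⟩ := Function.ne_iff.1 (hne x (hK0 x hx))
    rw [Set.mem_iUnion]
    rcases lt_or_gt_of_ne hj with h | h
    · exact ⟨(j, false), hK0 x hx, by simpa using h⟩
    · exact ⟨(j, true), hK0 x hx, by simpa using h⟩
  obtain ⟨δ, hδ, hL⟩ := lebesgue_number_lemma_of_metric hKc hU hKU
  obtain ⟨h₀, hh₀⟩ := exists_isHemisphereTower m
  obtain ⟨D, hD, h, hh⟩ := hh₀.exists_mesh_lt
    (by rintro _ ⟨σ, -, rfl⟩; exact convex_facet σ) (by norm_num) hδ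
  obtain ⟨s₀, hs₀⟩ := exists_odd_cochain (Fin (m + 1) → ℝ)
  let s : ℕ → (Fin (m + 1) → ℝ) → ZMod 2 := fun i x =>
    if hi : i < m then
      if 0 < f x ⟨i, hi⟩ then 1 else if f x ⟨i, hi⟩ < 0 then 0 else s₀ x
    else s₀ x
  have hs : ∀ C ∈ facets m, ∀ x ∈ C, ∀ i, s i (-x) = s i x + 1 := by
    intro C hC x hx i
    have h0 := hs₀ x (hK0 x (hfacet C hC hx))
    by_cases hi : i < m
    · simp only [s, hi, dif_pos, hodd, Pi.neg_apply]
      rcases lt_trichotomy (f x ⟨i, hi⟩) 0 with h | h | h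
      · simp [h, h.le]
      · simp [h, h0]
      · simp [h, h.not_gt]; decide
    · simp only [s, hi, dif_neg, not_false_iff, h0]
  have h1 := hh.eval_cup s hs m le_rfl
  have h2 : eval (cup s) (h m) = (0 : Chain (Fin (m + 1) → ℝ) →ₗ[ZMod 2] ZMod 2) (h m) := by
    refine linearMap_eq_of_supported _ _ ?_ (hh.mem_supported m le_rfl)
    intro l hl
    simp only [Set.mem_iUnion] at hl
    obtain ⟨C, hC, hl, hlC, hlD⟩ := hl
    obtain _ | ⟨x, l⟩ := l
    · simp at hl
    obtain ⟨⟨j, b⟩, hj⟩ := hL x (hfacet C hC (hlC x (by simp)))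
    have hmem : ∀ y ∈ x :: l, y ∈ U (j, b) := fun y hy =>
      hj ((hlD y hy x (by simp)).trans_lt hD)
    have hsU : ∀ y ∈ x :: l, s j y = if b then 1 else 0 := by
      intro y hy
      have := (hmem y hy).2
      cases b
      · have h3 : f y j < 0 := by simpa using this
        simp [s, h3, h3.le]
      · have h3 : 0 < f y j := by simpa using this
        simp [s, h3]
    rw [eval_single, LinearMap.zero_apply]
    refine cup_eq_zero s _ j (by rw [hl]; omega) fun y hy z hz => ?_
    rw [hsU y hy, hsU z hz]
  rw [h2] at h1
  exact zero_ne_one h1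

end BorsukUlamTheorem


section HamSandwich

variable {E : Type*} [NormedAddCommGroup E] [InnerProductSpace ℝ E] [FiniteDimensional ℝ E]
  [MeasurableSpace E] [BorelSpace E]

lemma measure_inner_eq_zero (ν : Measure E) (hac : ν ≪ volume) (u : E) (c : ℝ)
    (h : u ≠ 0 ∨ c ≠ 0) : ν {y | ⟪y, u⟫ - c = 0} = 0 := by
  by_cases hu : u = 0
  · have hc : c ≠ 0 := by tauto
    simp [hu, hc]
  apply hac
  let S : AffineSubspace ℝ E := AffineSubspace.mk' ((c / ⟪u, u⟫) • u) (ℝ ∙ u)ᗮ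
  have huu : ⟪u, u⟫ ≠ 0 := inner_self_ne_zero.2 hu
  have hS : {y : E | ⟪y, u⟫ - c = 0} = S := by
    ext y
    simp only [S, Set.mem_ofPred_eq, SetLike.mem_coe, AffineSubspace.mem_mk', vsub_eq_sub,
      Submodule.mem_orthogonal_singleton_iff_inner_left, inner_sub_left, real_inner_smul_left]
    rw [div_mul_cancel₀ _ huu]
  rw [hS]
  refine Measure.addHaar_affineSubspace _ _ fun htop => ?_
  have : S.direction = ⊤ := by rw [htop, AffineSubspace.direction_top]
  rw [AffineSubspace.direction_mk'] at this
  have hmem : u ∈ (ℝ ∙ u)ᗮ := this ▸ Submodule.mem_top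
  exact huu (Submodule.mem_orthogonal_singleton_iff_inner_left.1 hmem)

/-- The signed difference between the measures of the two sides of a hyperplane. -/
noncomputable def imbalance (ν : Measure E) (u : E) (c : ℝ) : ℝ :=
  ∫ y, Real.sign (⟪y, u⟫ - c) ∂ν

lemma measurable_sign : Measurable Real.sign := by
  unfold Real.sign
  exact Measurable.ite measurableSet_Iio measurable_const
    (Measurable.ite measurableSet_Ioi measurable_const measurable_const)

lemma continuousAt_sign {t : ℝ} (ht : t ≠ 0) : ContinuousAt Real.sign t := by
  rcases lt_or_gt_of_ne ht with h | h
  · exact continuousAt_const.congr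
      ((gt_mem_nhds h).mono fun y hy => (Real.sign_of_neg hy).symm)
  · exact continuousAt_const.congr
      ((lt_mem_nhds h).mono fun y hy => (Real.sign_of_pos hy).symm)

omit [FiniteDimensional ℝ E] [BorelSpace E] in
lemma imbalance_neg (ν : Measure E) (u : E) (c : ℝ) :
    imbalance ν (-u) (-c) = -imbalance ν u c := by
  rw [imbalance, imbalance, ← integral_neg]
  refine integral_congr_ae (Filter.Eventually.of_forall fun y => ?_)
  simp only [inner_neg_right]
  rw [← Real.sign_neg]
  congr 1
  ring

lemma continuousAt_imbalance (ν : Measure E) [IsFiniteMeasure ν] (hac : ν ≪ volume)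
    (p : E × ℝ) (hp : p.1 ≠ 0 ∨ p.2 ≠ 0) :
    ContinuousAt (fun q : E × ℝ => imbalance ν q.1 q.2) p := by
  refine continuousAt_of_dominated (bound := fun _ => 1)
    (Filter.Eventually.of_forall fun q => ?_) (Filter.Eventually.of_forall fun q =>
      Filter.Eventually.of_forall fun y => ?_) (integrable_const _) ?_
  · exact (measurable_sign.comp (by fun_prop)).aestronglyMeasurable
  · rcases Real.sign_apply_eq (⟪y, q.1⟫ - q.2) with h | h | h <;> simp [h]
  · have h0 : ∀ᵐ y ∂ν, ¬ (⟪y, p.1⟫ - p.2 = 0) := by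
      rw [ae_iff]
      simpa using measure_inner_eq_zero ν hac p.1 p.2 hp
    filter_upwards [h0] with y hy
    exact ContinuousAt.comp (f := fun q : E × ℝ => ⟪y, q.1⟫ - q.2) (continuousAt_sign hy)
      (by fun_prop)

lemma imbalance_eq (ν : Measure E) [IsFiniteMeasure ν] (u : E) (c : ℝ) :
    imbalance ν u c = ν.real {y | ⟪y, u⟫ - c ≥ 0} - ν.real {y | ⟪y, u⟫ - c ≤ 0} := by
  have h1 : MeasurableSet {y : E | ⟪y, u⟫ - c ≥ 0} :=
    measurableSet_le measurable_const (by fun_prop)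
  have h2 : MeasurableSet {y : E | ⟪y, u⟫ - c ≤ 0} :=
    measurableSet_le (by fun_prop) measurable_const
  rw [← integral_indicator_one h1, ← integral_indicator_one h2, ← integral_sub
    ((integrable_const 1).indicator h1) ((integrable_const 1).indicator h2)]
  refine integral_congr_ae (Filter.Eventually.of_forall fun y => ?_)
  generalize ht : ⟪y, u⟫ - c = t
  simp only [Set.indicator, Set.mem_ofPred_eq, ht, Pi.one_apply, ge_iff_le]
  rcases lt_trichotomy t 0 with h | rfl | h
  · simp [Real.sign, h, h.le, h.not_ge]
  · simp
  · simp [Real.sign, h, h.le, h.not_ge, h.not_gt]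

/-- The **ham sandwich theorem** for hyperplanes with normal vector in a given subspace. -/
theorem exists_bisecting_hyperplane (V : Submodule ℝ E) (m : ℕ) (hm : 1 ≤ m)
    (hV : m ≤ finrank ℝ V) (ν : Fin m → Measure E) [∀ i, IsFiniteMeasure (ν i)]
    (hac : ∀ i, ν i ≪ volume) :
    ∃ u ∈ V, u ≠ 0 ∧ ∃ c : ℝ, ∀ i, ν i {y | ⟪y, u⟫ - c ≥ 0} = ν i {y | ⟪y, u⟫ - c ≤ 0} := by
  obtain ⟨b, hb⟩ := exists_linearIndependent_of_le_finrank hV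
  let L : (Fin m → ℝ) →ₗ[ℝ] E := V.subtype ∘ₗ Fintype.linearCombination ℝ b
  have hLV : ∀ x, L x ∈ V := fun x => (Fintype.linearCombination ℝ b x).2
  have hL : Function.Injective L :=
    V.injective_subtype.comp (hb.fintypeLinearCombination_injective)
  let P : (Fin (m + 1) → ℝ) → E × ℝ := fun x => (L fun i => x i.castSucc, x (Fin.last m))
  have hP : Continuous P := by
    have := L.continuous_of_finiteDimensional
    fun_prop
  have hP0 : ∀ x ≠ 0, (P x).1 ≠ 0 ∨ (P x).2 ≠ 0 := by
    intro x hx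
    by_contra! h
    apply hx
    have h1 := (map_eq_zero_iff L hL).1 h.1
    funext j
    refine Fin.lastCases h.2 (fun i => congrFun h1 i) j
  obtain ⟨x, hx, hfx⟩ := exists_eq_zero m (fun x i => imbalance (ν i) (P x).1 (P x).2)
    (continuousOn_pi.2 fun i x hx =>
      (ContinuousAt.comp (f := P) (continuousAt_imbalance (ν i) (hac i) (P x) (hP0 x hx))
        hP.continuousAt).continuousWithinAt)
    (fun x => by
      funext i
      have h1 : (P (-x)).1 = -(P x).1 := by
        rw [← map_neg]; rfl
      rw [Pi.neg_apply, ← imbalance_neg, h1]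
      rfl)
  have key : ∀ i, ν i {y | ⟪y, (P x).1⟫ - (P x).2 ≥ 0} = ν i {y | ⟪y, (P x).1⟫ - (P x).2 ≤ 0} := by
    intro i
    have := congrFun hfx i
    rw [imbalance_eq, Pi.zero_apply, sub_eq_zero] at this
    exact (measureReal_eq_measureReal_iff).1 this
  by_cases hu : (P x).1 = 0
  · have hc : (P x).2 ≠ 0 := (hP0 x hx).resolve_left (not_not.2 hu)
    have hν : ∀ i, ν i = 0 := by
      intro i
      have := key i
      rw [← Measure.measure_univ_eq_zero]
      rcases lt_or_gt_of_ne hc with h | h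
      · simpa [hu, h.le, h.not_ge] using this
      · simpa [hu, h.le, h.not_ge] using this.symm
    obtain ⟨w, hw⟩ : ∃ w : V, w ≠ 0 := by
      have : Nontrivial V := Module.nontrivial_of_finrank_pos (R := ℝ) (by omega)
      exact exists_ne 0
    exact ⟨w, w.2, by simpa using hw, 0, by simp [hν]⟩
  · exact ⟨(P x).1, hLV _, hu, (P x).2, key⟩

/-- Pairwise orthogonal bisecting hyperplanes. -/
theorem exists_orthogonal_bisecting_hyperplanes (n k : ℕ) (hE : finrank ℝ E = k + n)
    (ν : ∀ t : Fin n, Fin (k + (t : ℕ) + 1) → Measure E) [∀ t i, IsFiniteMeasure (ν t i)]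
    (hac : ∀ t i, ν t i ≪ volume) :
    ∃ (v : Fin n → E) (c : Fin n → ℝ), (∀ t, v t ≠ 0) ∧ (∀ s t, s ≠ t → ⟪v s, v t⟫ = 0) ∧
      ∀ t i, ν t i {y | ⟪y, v t⟫ - c t ≥ 0} = ν t i {y | ⟪y, v t⟫ - c t ≤ 0} := by
  suffices h : ∀ r ≤ n, ∃ (v : Fin n → E) (c : Fin n → ℝ), ∀ t : Fin n, n ≤ t + r →
      v t ≠ 0 ∧ (∀ s, t < s → ⟪v s, v t⟫ = 0) ∧
      ∀ i, ν t i {y | ⟪y, v t⟫ - c t ≥ 0} = ν t i {y | ⟪y, v t⟫ - c t ≤ 0} by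
    obtain ⟨v, c, h⟩ := h n le_rfl
    refine ⟨v, c, fun t => (h t (by omega)).1, fun s t hst => ?_,
      fun t => (h t (by omega)).2.2⟩
    rcases lt_or_gt_of_ne hst with hlt | hlt
    · rw [real_inner_comm]; exact (h s (by omega)).2.1 t hlt
    · exact (h t (by omega)).2.1 s hlt
  intro r hr
  induction r with
  | zero => exact ⟨0, 0, fun t ht => by omega⟩
  | succ r ih =>
    obtain ⟨v, c, h⟩ := ih (by omega)
    let t₀ : Fin n := ⟨n - (r + 1), by omega⟩
    let W : Submodule ℝ E := Submodule.span ℝ (Set.range fun s : Finset.Ioi t₀ => v s)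
    have hW : finrank ℝ W ≤ r := by
      refine (finrank_range_le_card _).trans ?_
      rw [Fintype.card_coe, Fin.card_Ioi]
      simp [t₀]; omega
    have hW' := W.finrank_add_finrank_orthogonal
    obtain ⟨u, huW, hu, c₀, hc₀⟩ := exists_bisecting_hyperplane Wᗮ (k + (t₀ : ℕ) + 1) (by omega)
      (by simp only [t₀]; omega) (ν t₀) (hac t₀)
    refine ⟨Function.update v t₀ u, Function.update c t₀ c₀, fun t ht => ?_⟩
    by_cases htt : t = t₀
    · subst htt
      simp only [Function.update_self]
      refine ⟨hu, fun s hs => ?_, hc₀⟩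
      rw [Function.update_of_ne hs.ne']
      exact huW _ (Submodule.subset_span ⟨⟨s, Finset.mem_Ioi.2 hs⟩, rfl⟩)
    · have hlt : t₀ < t := by
        have : (t : ℕ) ≠ t₀ := fun h => htt (Fin.ext h)
        rw [Fin.lt_def]
        simp only [t₀] at this ⊢
        omega
      obtain ⟨h1, h2, h3⟩ := h t (by rw [Fin.lt_def] at hlt; simp only [t₀] at hlt; omega)
      simp only [Function.update_of_ne htt]
      refine ⟨h1, fun s hs => ?_, h3⟩
      rw [Function.update_of_ne (hlt.trans hs).ne']
      exact h2 s hs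

end HamSandwich

end BorsukUlam



/-- **Fairy Bread Sandwich theorem** for mass assignments given by orthogonal projections of
fixed measures.  For each level `i = k-1+j` (with `j : Fin (d-k+1)`) we are given
`π_i + 1` finite absolutely continuous measures on `ℝ^d`, where `(π_{d-1},…,π_{k-1})` is a
permutation of `(d-1,…,k-1)` (encoded by a permutation `π` of `Fin (d-k+1)`, the value being
`k-1+π j`).  Then there is a full flag of affine subspaces
`S_{k-1} ⊂ S_k ⊂ ⋯ ⊂ S_{d-1} ⊂ S_d = ℝ^d`, `dim S_i = i`, such that for each level the
subspace `S_i` bisects the orthogonal projection onto `S_{i+1}` of each of the corresponding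
measures.  Bisection is expressed via a vector `u` in the direction of `S_{i+1}` orthogonal
to the direction of `S_i` and a point `p ∈ S_i`: since `u` lies in the direction of
`S_{i+1}`, the preimage under the orthogonal projection onto `S_{i+1}` of the closed
half-space `{x ∈ S_{i+1} : ⟪x - p, u⟫ ≥ 0}` is exactly `{x : ⟪x - p, u⟫ ≥ 0}`, so the stated
equalities say precisely that the two closed half-spaces of `S_{i+1}` bounded by `S_i` have
equal measure for the projected measures. -/
theorem fairy_bread_sandwich (d k : ℕ) (hk : 1 ≤ k) (hkd : k ≤ d)
    (π : Equiv.Perm (Fin (d - k + 1)))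
    (ν : ∀ j : Fin (d - k + 1), Fin (k - 1 + (π j : ℕ) + 1) →
      Measure (EuclideanSpace ℝ (Fin d)))
    [∀ j m, IsFiniteMeasure (ν j m)]
    (hac : ∀ j m, ν j m ≪ volume) :
    ∃ S : Fin (d - k + 2) → AffineSubspace ℝ (EuclideanSpace ℝ (Fin d)),
      S (Fin.last (d - k + 1)) = ⊤ ∧
      (∀ j : Fin (d - k + 2), (S j : Set (EuclideanSpace ℝ (Fin d))).Nonempty ∧
        finrank ℝ (S j).direction = k - 1 + (j : ℕ)) ∧
      (∀ j : Fin (d - k + 1), S j.castSucc ≤ S j.succ) ∧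
      (∀ j : Fin (d - k + 1), ∃ (u p : EuclideanSpace ℝ (Fin d)),
        u ∈ (S j.succ).direction ∧ u ≠ 0 ∧
        (∀ w ∈ (S j.castSucc).direction, ⟪u, w⟫ = 0) ∧ p ∈ S j.castSucc ∧
        ∀ m : Fin (k - 1 + (π j : ℕ) + 1),
          ν j m {x | ⟪x - p, u⟫ ≥ 0} = ν j m {x | ⟪x - p, u⟫ ≤ 0}) := by
  let n := d - k + 1
  obtain ⟨v₀, c₀, hv₀, horth₀, hbis₀⟩ := BorsukUlam.exists_orthogonal_bisecting_hyperplanes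
    (E := EuclideanSpace ℝ (Fin d)) n (k - 1) (by simp [n]; omega)
    (fun t i => ν (π.symm t) (Fin.cast (by simp) i)) (fun t i => hac _ _)
  obtain ⟨v, c, hv, horth, hbis⟩ : ∃ (v : Fin n → EuclideanSpace ℝ (Fin d)) (c : Fin n → ℝ),
      (∀ j, v j ≠ 0) ∧ (∀ i j, i ≠ j → ⟪v i, v j⟫ = 0) ∧
      ∀ j i, ν j i {y | ⟪y, v j⟫ - c j ≥ 0} = ν j i {y | ⟪y, v j⟫ - c j ≤ 0} := by
    refine ⟨v₀ ∘ π, c₀ ∘ π, fun j => hv₀ _, fun i j hij => horth₀ _ _ (π.injective.ne hij), ?_⟩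
    intro j
    obtain ⟨t, rfl⟩ := π.symm.surjective j
    intro i
    simpa using hbis₀ t (Fin.cast (by simp) i)
  have hlin : LinearIndependent ℝ v :=
    linearIndependent_of_ne_zero_of_inner_eq_zero hv fun i j hij => horth i j hij
  let p : EuclideanSpace ℝ (Fin d) := ∑ i, (c i / ⟪v i, v i⟫) • v i
  have hp : ∀ j, ⟪p, v j⟫ = c j := by
    intro j
    rw [sum_inner, Finset.sum_eq_single j]
    · rw [real_inner_smul_left, div_mul_cancel₀ _ (inner_self_ne_zero.2 (hv j))]
    · intro i _ hij
      rw [real_inner_smul_left, horth i j hij, mul_zero]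
    · simp
  let W : ℕ → Submodule ℝ (EuclideanSpace ℝ (Fin d)) := fun j =>
    Submodule.span ℝ (v '' {i | j ≤ (i : ℕ)})
  have hW : ∀ j ≤ n, finrank ℝ (W j) = n - j := by
    intro j hj
    have h1 : W j = Submodule.span ℝ
        (Set.range fun i : Finset.univ.filter fun i : Fin n => j ≤ (i : ℕ) => v i) := by
      simp only [W]
      congr 1
      ext x
      simp
    rw [h1]
    refine (finrank_span_eq_card (hlin.comp _ Subtype.val_injective)).trans ?_
    rw [Fintype.card_coe, ← Finset.card_map Fin.valEmbedding, ← Nat.card_Ico]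
    congr 1
    ext i
    simp [Fin.exists_iff, and_comm]
  refine ⟨fun j => AffineSubspace.mk' p (W j)ᗮ, ?_, fun j => ⟨?_, ?_⟩, fun j => ?_, fun j => ?_⟩
  · have : W (Fin.last (d - k + 1) : ℕ) = ⊥ := by
      simp only [W, Submodule.span_eq_bot]
      rintro _ ⟨i, hi, rfl⟩
      have := i.2
      simp [n] at hi this
      omega
    simp only [this, Submodule.bot_orthogonal_eq_top]
    ext x
    simp
  · exact AffineSubspace.mk'_nonempty _ _
  · rw [AffineSubspace.direction_mk']
    have h1 := (W j).finrank_add_finrank_orthogonal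
    have h2 := hW j (by simp only [n]; omega)
    rw [finrank_euclideanSpace_fin] at h1
    simp only [n] at h2
    omega
  · intro x hx
    rw [AffineSubspace.mem_mk'] at hx ⊢
    refine Submodule.orthogonal_le (Submodule.span_mono (Set.image_mono fun i hi => ?_)) hx
    exact (Nat.le_succ _).trans (by simpa using hi)
  · refine ⟨v j, p, ?_, hv j, fun w hw => ?_, AffineSubspace.self_mem_mk' _ _, fun m => ?_⟩
    · rw [AffineSubspace.direction_mk', Submodule.mem_orthogonal]
      intro w hw
      induction hw using Submodule.span_induction with
      | mem x hx =>
        obtain ⟨i, hi, rfl⟩ := hx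
        refine horth i j fun h => ?_
        subst h
        simp at hi
      | zero => simp
      | add x y _ _ hx hy => rw [inner_add_left, hx, hy, add_zero]
      | smul a x _ hx => rw [real_inner_smul_left, hx, mul_zero]
    · rw [AffineSubspace.direction_mk'] at hw
      exact hw _ (Submodule.subset_span ⟨j, by simp, rfl⟩)
    · simpa only [inner_sub_left, hp] using hbis j m
end
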